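/- arXiv:2003.12833 — 2 statements merged into one kernel-verified Lean document; each statement's English description precedes it below -/
import Mathlib

section
/- Every convex body D ⊆ ℝ² possesses optimal polynomial meshes: there exist constants μ, ν > 0 (depending only on D) such that for every integer n ≥ 1 there is a finite set Yₙ ⊆ D of cardinality at most μ·n² with max_{y∈D} |p(y)| ≤ ν · max_{y∈Yₙ} |p(y)| for every real polynomial p in two variables of total degree ≤ n. -/
open MeasureTheory Set Pointwise

noncomputable section

abbrev E (d : ℕ) := EuclideanSpace ℝ (Fin d)
abbrev E2 := EuclideanSpace ℝ (Fin 2)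

/-- The Christoffel function `λ_n(x, D)` for Lebesgue measure on `D ⊆ ℝ^d`. -/
noncomputable def christoffel (d n : ℕ) (x : E d) (D : Set (E d)) : ℝ :=
  sInf { r : ℝ | ∃ p : MvPolynomial (Fin d) ℝ, p.totalDegree ≤ n ∧
    MvPolynomial.eval (fun i => x i) p = 1 ∧
    r = ∫ y in D, (MvPolynomial.eval (fun i => y i) p) ^ 2 }

/-- Determinant of the linear part of an affine automorphism of `ℝ^d`. -/
noncomputable def adet {d : ℕ} (T : E d ≃ᵃ[ℝ] E d) : ℝ :=
  LinearMap.det (T.linear : E d →ₗ[ℝ] E d)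

/-- The closed unit ball `B` of `ℝ²`. -/
def ballE : Set E2 := Metric.closedBall 0 1

/-- The unit square `S = [0,1]²` in `ℝ²`. -/
def squareS : Set E2 := {y : E2 | y 0 ∈ Icc (0:ℝ) 1 ∧ y 1 ∈ Icc (0:ℝ) 1}

/-- The geometric quantity `L(x, D)`. -/
noncomputable def Lfun (x : E2) (D : Set E2) : ℝ :=
  sSup { r : ℝ | ∃ T : E2 ≃ᵃ[ℝ] E2, x ∈ T '' ballE ∧ T '' ballE ⊆ D ∧
    r = Real.sqrt (1 - ‖T.symm x‖) * |adet T| }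

/-- The geometric quantity `U(x, D)`. -/
noncomputable def Ufun (x : E2) (D : Set E2) : ℝ :=
  sInf { r : ℝ | ∃ T : E2 ≃ᵃ[ℝ] E2, x ∈ T '' ((2:ℝ)⁻¹ • squareS) ∧ D ⊆ T '' squareS ∧
    r = Real.sqrt ((T.symm x) 0 * (T.symm x) 1) * |adet T| }

/-- A convex body in `ℝ²`: a compact convex set with nonempty interior. -/
def IsConvexBody (D : Set E2) : Prop := Convex ℝ D ∧ IsCompact D ∧ (interior D).Nonempty

/-- The point `(a, b)` of `ℝ²`. -/
noncomputable def e2 (a b : ℝ) : E2 := (WithLp.equiv 2 (Fin 2 → ℝ)).symm ![a, b]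

/-- `z ^ m * q ((z + z⁻¹) / 2)`, as a polynomial in `z`, for `q` of degree at most `m`. -/
def joukowskyPoly (q : Polynomial ℝ) (m : ℕ) : Polynomial ℂ :=
  ∑ k ∈ Finset.range (m + 1), Polynomial.C ((q.coeff k : ℂ) / 2 ^ k) *
    Polynomial.X ^ (m - k) * (Polynomial.X ^ 2 + 1) ^ k

theorem joukowskyPoly_eval (q : Polynomial ℝ) (m : ℕ) (hq : q.natDegree ≤ m) (z : ℂ)
    (hz : z ≠ 0) : (joukowskyPoly q m).eval z =
      z ^ m * (q.map Complex.ofRealHom).eval ((z + z⁻¹) / 2) := by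
  have hd : (q.map Complex.ofRealHom).natDegree < m + 1 :=
    lt_of_le_of_lt Polynomial.natDegree_map_le (by omega)
  rw [Polynomial.eval_eq_sum_range' hd, joukowskyPoly, Polynomial.eval_finsetSum, Finset.mul_sum]
  refine Finset.sum_congr rfl fun k hk => ?_
  have hk' : k ≤ m := by
    have := Finset.mem_range.1 hk
    omega
  obtain ⟨j, rfl⟩ := Nat.exists_eq_add_of_le hk'
  have h1 : (z ^ 2 + 1) = z * (z + z⁻¹) := by field_simp
  simp only [Polynomial.eval_mul, Polynomial.eval_C, Polynomial.eval_pow, Polynomial.eval_X,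
    Polynomial.eval_add, Polynomial.eval_one, Polynomial.coeff_map, Nat.add_sub_cancel_left, h1,
    Complex.ofRealHom_eq_coe, div_pow, mul_pow, pow_add]
  ring

theorem joukowskyPoly_eval_inv (q : Polynomial ℝ) (m : ℕ) (hq : q.natDegree ≤ m) (z : ℂ)
    (hz : z ≠ 0) : (joukowskyPoly q m).eval z = z ^ (2 * m) * (joukowskyPoly q m).eval z⁻¹ := by
  rw [joukowskyPoly_eval q m hq z hz, joukowskyPoly_eval q m hq z⁻¹ (inv_ne_zero hz), inv_inv,
    add_comm z⁻¹ z, inv_pow]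
  field_simp
  ring

theorem joukowskyPoly_eval_circle (q : Polynomial ℝ) (m : ℕ) (hq : q.natDegree ≤ m) (θ : ℝ) :
    (joukowskyPoly q m).eval (Complex.exp (θ * Complex.I)) =
      Complex.exp (θ * Complex.I) ^ m * (q.eval (Real.cos θ) : ℝ) := by
  rw [joukowskyPoly_eval q m hq _ (Complex.exp_ne_zero _), ← Complex.exp_neg]
  have : (Complex.exp (θ * Complex.I) + Complex.exp (-(θ * Complex.I))) / 2
      = Complex.ofRealHom (Real.cos θ) := by
    rw [Complex.ofRealHom_eq_coe, Complex.ofReal_cos, Complex.cos, neg_mul]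
  rw [this, Polynomial.eval_map, Polynomial.eval₂_hom]
  rfl

theorem norm_joukowskyPoly_eval_le_of_norm_le_one (q : Polynomial ℝ) (m : ℕ)
    (hq : q.natDegree ≤ m) (M : ℝ)
    (hM : ∀ x ∈ Icc (-1 : ℝ) 1, |q.eval x| ≤ M) (z : ℂ) (hz : ‖z‖ ≤ 1) :
    ‖(joukowskyPoly q m).eval z‖ ≤ M := by
  refine Complex.norm_le_of_forall_mem_frontier_norm_le (U := Metric.ball 0 1)
    (f := fun z => (joukowskyPoly q m).eval z) Metric.isBounded_ball
    (joukowskyPoly q m).differentiable.diffContOnCl ?_ ?_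
  · intro w hw
    rw [frontier_ball _ one_ne_zero, mem_sphere_zero_iff_norm] at hw
    have h1 : w = Complex.exp (w.arg * Complex.I) := by
      have := Complex.norm_mul_exp_arg_mul_I w
      rw [hw] at this
      simpa using this.symm
    rw [h1, joukowskyPoly_eval_circle q m hq, norm_mul, norm_pow, Complex.norm_exp_ofReal_mul_I,
      one_pow, one_mul, Complex.norm_real]
    exact hM _ ⟨Real.neg_one_le_cos _, Real.cos_le_one _⟩
  · rw [closure_ball _ one_ne_zero]
    simpa using hz

theorem norm_joukowskyPoly_eval_le_of_one_le_norm (q : Polynomial ℝ) (m : ℕ)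
    (hq : q.natDegree ≤ m) (M : ℝ)
    (hM : ∀ x ∈ Icc (-1 : ℝ) 1, |q.eval x| ≤ M) (z : ℂ) (hz : 1 ≤ ‖z‖) :
    ‖(joukowskyPoly q m).eval z‖ ≤ ‖z‖ ^ (2 * m) * M := by
  have h0 : z ≠ 0 := by
    rintro rfl
    norm_num at hz
  rw [joukowskyPoly_eval_inv q m hq z h0, norm_mul, norm_pow]
  gcongr
  refine norm_joukowskyPoly_eval_le_of_norm_le_one q m hq M hM _ ?_
  rw [norm_inv]
  exact inv_le_one_of_one_le₀ hz

theorem norm_deriv_joukowskyPoly_le (q : Polynomial ℝ) (m : ℕ) (hm : 0 < m)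
    (hq : q.natDegree ≤ m) (M : ℝ)
    (hM : ∀ x ∈ Icc (-1 : ℝ) 1, |q.eval x| ≤ M) (z : ℂ) (hz : ‖z‖ = 1) :
    ‖(joukowskyPoly q m).derivative.eval z‖ ≤ 6 * m * M := by
  have hM0 : 0 ≤ M := (abs_nonneg _).trans (hM 0 (by simp))
  have hm' : (0 : ℝ) < 2 * m := by positivity
  have key : ‖deriv (fun z => (joukowskyPoly q m).eval z) z‖ ≤ (3 * M) / (1 / (2 * m)) := by
    refine Complex.norm_deriv_le_of_forall_mem_sphere_norm_le (by positivity)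
      (joukowskyPoly q m).differentiable.diffContOnCl ?_
    intro w hw
    rw [mem_sphere_iff_norm] at hw
    rcases le_total ‖w‖ 1 with h | h
    · exact (norm_joukowskyPoly_eval_le_of_norm_le_one q m hq M hM w h).trans (by linarith)
    · refine (norm_joukowskyPoly_eval_le_of_one_le_norm q m hq M hM w h).trans ?_
      gcongr
      have h2 : ‖w‖ ≤ 1 + 1 / (2 * m) := by
        have := norm_le_norm_add_norm_sub' w z
        rw [hz, hw] at this
        exact this
      calc ‖w‖ ^ (2 * m) ≤ (Real.exp (1 / (2 * m))) ^ (2 * m) := by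
            gcongr
            linarith [Real.add_one_le_exp (1 / (2 * m : ℝ))]
        _ = Real.exp 1 := by
            rw [← Real.exp_nat_mul]
            congr 1
            push_cast
            field_simp
        _ ≤ 3 := by linarith [Real.exp_one_lt_d9]
  rw [Polynomial.deriv] at key
  refine key.trans (le_of_eq ?_)
  field_simp
  ring

/-- **Bernstein's inequality**, with a non-optimal constant. -/
theorem abs_eval_cos_sub_eval_cos_le (q : Polynomial ℝ) (m : ℕ) (hq : q.natDegree ≤ m) (M : ℝ)
    (hM : ∀ x ∈ Icc (-1 : ℝ) 1, |q.eval x| ≤ M) (α β : ℝ) :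
    |q.eval (Real.cos α) - q.eval (Real.cos β)| ≤ 7 * m * M * |α - β| := by
  have hM0 : 0 ≤ M := (abs_nonneg _).trans (hM 0 (by simp))
  rcases Nat.eq_zero_or_pos m with rfl | hm
  · rw [Polynomial.eq_C_of_natDegree_le_zero hq]
    simp
  set T : ℝ → ℂ := fun θ => Complex.exp (-(m * (θ * Complex.I))) *
    (joukowskyPoly q m).eval (Complex.exp (θ * Complex.I)) with hT
  have hTe : ∀ θ : ℝ, T θ = (q.eval (Real.cos θ) : ℝ) := by
    intro θ
    simp only [hT]
    rw [joukowskyPoly_eval_circle q m hq, ← Complex.exp_nat_mul, ← mul_assoc, ← Complex.exp_add]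
    simp
  have hder : ∀ θ : ℝ, HasDerivAt T (Complex.exp (-(m * (θ * Complex.I))) * (-(m * Complex.I)) *
      (joukowskyPoly q m).eval (Complex.exp (θ * Complex.I)) +
      Complex.exp (-(m * (θ * Complex.I))) * ((joukowskyPoly q m).derivative.eval
        (Complex.exp (θ * Complex.I)) * (Complex.exp (θ * Complex.I) * Complex.I))) θ := by
    intro θ
    have h0 : HasDerivAt (fun θ : ℝ => (θ : ℂ) * Complex.I) Complex.I θ := by
      simpa using (Complex.ofRealCLM.hasDerivAt (x := θ)).mul_const Complex.I
    have h1 : HasDerivAt (fun θ : ℝ => -((m : ℂ) * ((θ : ℂ) * Complex.I)))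
        (-(m * Complex.I)) θ := (h0.const_mul (m : ℂ)).neg
    have h2 : HasDerivAt (fun θ : ℝ => (joukowskyPoly q m).eval (Complex.exp (θ * Complex.I)))
        ((joukowskyPoly q m).derivative.eval (Complex.exp (θ * Complex.I)) *
          (Complex.exp (θ * Complex.I) * Complex.I)) θ :=
      HasDerivAt.comp θ (h₂ := fun w => (joukowskyPoly q m).eval w)
        ((joukowskyPoly q m).hasDerivAt (Complex.exp (θ * Complex.I))) h0.cexp
    exact h1.cexp.mul h2
  have hb : ∀ θ ∈ (univ : Set ℝ), ‖Complex.exp (-(m * (θ * Complex.I))) * (-(m * Complex.I)) *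
      (joukowskyPoly q m).eval (Complex.exp (θ * Complex.I)) +
      Complex.exp (-(m * (θ * Complex.I))) * ((joukowskyPoly q m).derivative.eval
        (Complex.exp (θ * Complex.I)) * (Complex.exp (θ * Complex.I) * Complex.I))‖
      ≤ 7 * m * M := by
    intro θ _
    have e1 : ‖Complex.exp (-(m * (θ * Complex.I)))‖ = 1 := by
      rw [show -((m : ℂ) * (θ * Complex.I)) = ((-(m * θ) : ℝ) : ℂ) * Complex.I by push_cast; ring]
      exact Complex.norm_exp_ofReal_mul_I _
    have e2 : ‖Complex.exp (θ * Complex.I)‖ = 1 := Complex.norm_exp_ofReal_mul_I _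
    refine (norm_add_le _ _).trans ?_
    simp only [norm_mul, e1, e2, norm_neg, Complex.norm_I, Complex.norm_natCast, one_mul, mul_one]
    have i1 := norm_joukowskyPoly_eval_le_of_norm_le_one q m hq M hM _ e2.le
    have i2 := norm_deriv_joukowskyPoly_le q m hm hq M hM _ e2
    have : (m : ℝ) * ‖(joukowskyPoly q m).eval (Complex.exp (θ * Complex.I))‖ ≤ m * M := by
      gcongr
    linarith
  have := Convex.norm_image_sub_le_of_norm_hasDerivWithin_le
    (fun θ _ => (hder θ).hasDerivWithinAt) hb convex_univ (mem_univ β) (mem_univ α)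
  rw [hTe, hTe, ← Complex.ofReal_sub, Complex.norm_real] at this
  exact this

/-- `P` is `L`-Lipschitz in the arccosine parametrization along every quadratic curve
`t ↦ a + t b + t² c`, `t ∈ [-1, 1]`, contained in `D`. -/
def QuadLip {V : Type*} [AddCommGroup V] [Module ℝ V] (D : Set V) (L : ℝ) (P : V → ℝ) : Prop :=
  ∀ a b c : V, (∀ t ∈ Icc (-1 : ℝ) 1, a + t • b + t ^ 2 • c ∈ D) → ∀ α β : ℝ,
    |P (a + Real.cos α • b + Real.cos α ^ 2 • c) -
      P (a + Real.cos β • b + Real.cos β ^ 2 • c)| ≤ L * |α - β|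

theorem quadLip_mvPolynomial_eval (D : Set E2) (n : ℕ) (p : MvPolynomial (Fin 2) ℝ)
    (hp : p.totalDegree ≤ n) (M : ℝ)
    (hM : ∀ z ∈ D, |MvPolynomial.eval (fun i => z i) p| ≤ M) :
    QuadLip D (14 * n * M) (fun z : E2 => MvPolynomial.eval (fun i => z i) p) := by
  intro a b c hD α β
  set f : Fin 2 → Polynomial ℝ := fun i => Polynomial.C (a i) + Polynomial.C (b i) * Polynomial.X +
    Polynomial.C (c i) * Polynomial.X ^ 2 with hf
  have hfd : ∀ i, (f i).natDegree ≤ 2 := by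
    intro i
    simp only [hf]
    compute_degree
  have hd : (MvPolynomial.aeval f p).natDegree ≤ n * 2 :=
    MvPolynomial.aeval_natDegree_le p hp f hfd
  have he : ∀ t : ℝ, (MvPolynomial.aeval f p).eval t =
      MvPolynomial.eval (fun i => (a + t • b + t ^ 2 • c) i) p := by
    intro t
    rw [← Polynomial.coe_aeval_eq_eval, MvPolynomial.comp_aeval_apply,
      ← MvPolynomial.aeval_eq_eval]
    congr 2
    funext i
    simp [hf]
    ring
  have := abs_eval_cos_sub_eval_cos_le _ _ hd M
    (fun x hx => by rw [he]; exact hM _ (hD x hx)) α β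
  rw [he, he] at this
  refine this.trans (le_of_eq ?_)
  push_cast
  ring

theorem QuadLip.comp_affine {V W : Type*} [AddCommGroup V] [Module ℝ V] [AddCommGroup W]
    [Module ℝ W] {D : Set W} {L : ℝ} {P : W → ℝ} (h : QuadLip D L P) (z : W) (φ : V →ₗ[ℝ] W) :
    QuadLip ((fun v => z + φ v) ⁻¹' D) L (fun v => P (z + φ v)) := by
  intro a b c hD α β
  have key : ∀ t : ℝ, z + φ (a + t • b + t ^ 2 • c) = (z + φ a) + t • φ b + t ^ 2 • φ c := by
    intro t
    simp only [map_add, map_smul]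
    abel
  simp only [mem_preimage, key] at hD ⊢
  exact h _ _ _ hD α β

open scoped Classical in
/-- A discrete weak-type bound for the right-sided maximal slope of a monotone sequence. -/
theorem mul_card_right_steep_le {F : ℕ → ℝ} (hF : Monotone F) {r : ℝ} (hr : 0 < r) (N : ℕ) :
    ∀ d m : ℕ, m + d = N →
      r * ((Finset.Ico m N).filter
        (fun i : ℕ => ∃ j : ℕ, i < j ∧ j ≤ N ∧ r * ((j : ℝ) - i) ≤ F j - F i)).card ≤ F N - F m := by
  intro d
  induction d using Nat.strong_induction_on with
  | _ d ih =>
    intro m hm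
    rcases Nat.eq_zero_or_pos d with rfl | hd
    · obtain rfl : m = N := by omega
      simp
    have hsplit : ∀ j, m ≤ j → j ≤ N → Finset.Ico m N = Finset.Ico m j ∪ Finset.Ico j N :=
      fun j h1 h2 => (Finset.Ico_union_Ico_eq_Ico h1 h2).symm
    by_cases h : ∃ j, m < j ∧ j ≤ N ∧ r * ((j : ℝ) - m) ≤ F j - F m
    · obtain ⟨j, hmj, hjN, hj⟩ := h
      have h1 := ih (N - j) (by omega) j (by omega)
      rw [hsplit j hmj.le hjN, Finset.filter_union]
      have h2 := (Finset.card_union_le _ _).trans (add_le_add_left (Finset.card_filter_le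
        (Finset.Ico m j) (fun i : ℕ => ∃ j : ℕ, i < j ∧ j ≤ N ∧ r * ((j : ℝ) - i) ≤ F j - F i))
        ((Finset.Ico j N).filter
          (fun i : ℕ => ∃ j : ℕ, i < j ∧ j ≤ N ∧ r * ((j : ℝ) - i) ≤ F j - F i)).card)
      rw [Nat.card_Ico] at h2
      have h3 := mul_le_mul_of_nonneg_left (Nat.cast_le (α := ℝ).2 h2) hr.le
      rw [Nat.cast_add, Nat.cast_sub hmj.le, mul_add] at h3
      linarith
    · have h1 := ih (d - 1) (by omega) (m + 1) (by omega)
      rw [hsplit (m + 1) (by omega) (by omega), Finset.filter_union]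
      have h2 : (Finset.Ico m (m + 1)).filter
          (fun i : ℕ => ∃ j : ℕ, i < j ∧ j ≤ N ∧ r * ((j : ℝ) - i) ≤ F j - F i) = ∅ := by
        rw [Finset.filter_eq_empty_iff]
        intro i hi
        obtain rfl : i = m := by
          have := Finset.mem_Ico.1 hi
          omega
        exact h
      rw [h2, Finset.empty_union]
      linarith [hF (Nat.le_succ m)]

open scoped Classical in
/-- A discrete weak-type bound for the left-sided maximal slope of a monotone sequence. -/
theorem mul_card_left_steep_le {F : ℕ → ℝ} (hF : Monotone F) {r : ℝ} (hr : 0 < r) :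
    ∀ N : ℕ, r * ((Finset.Ioc 0 N).filter
        (fun i : ℕ => ∃ j : ℕ, j < i ∧ r * ((i : ℝ) - j) ≤ F i - F j)).card ≤ F N - F 0 := by
  intro N
  induction N using Nat.strong_induction_on with
  | _ N ih =>
    rcases Nat.eq_zero_or_pos N with rfl | hN
    · simp
    have hsplit : ∀ j ≤ N, Finset.Ioc 0 N = Finset.Ioc 0 j ∪ Finset.Ioc j N :=
      fun j h2 => (Finset.Ioc_union_Ioc_eq_Ioc (Nat.zero_le j) h2).symm
    by_cases h : ∃ j, j < N ∧ r * ((N : ℝ) - j) ≤ F N - F j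
    · obtain ⟨j, hjN, hj⟩ := h
      have h1 := ih j hjN
      rw [hsplit j hjN.le, Finset.filter_union]
      have h2 := (Finset.card_union_le _ _).trans (add_le_add_right (Finset.card_filter_le
        (Finset.Ioc j N) (fun i : ℕ => ∃ j : ℕ, j < i ∧ r * ((i : ℝ) - j) ≤ F i - F j))
        ((Finset.Ioc 0 j).filter (fun i : ℕ => ∃ j : ℕ, j < i ∧ r * ((i : ℝ) - j) ≤ F i - F j)).card)
      rw [Nat.card_Ioc] at h2
      have h3 := mul_le_mul_of_nonneg_left (Nat.cast_le (α := ℝ).2 h2) hr.le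
      rw [Nat.cast_add, Nat.cast_sub hjN.le, mul_add] at h3
      linarith
    · have h1 := ih (N - 1) (by omega)
      rw [hsplit (N - 1) (by omega), Finset.filter_union]
      have h2 : (Finset.Ioc (N - 1) N).filter
          (fun i : ℕ => ∃ j : ℕ, j < i ∧ r * ((i : ℝ) - j) ≤ F i - F j) = ∅ := by
        rw [Finset.filter_eq_empty_iff]
        intro i hi
        obtain rfl : i = N := by
          have := Finset.mem_Ioc.1 hi
          omega
        exact h
      rw [h2, Finset.union_empty]
      linarith [hF (Nat.sub_le N 1)]

/-- Weak-type control of `M` implies control of the sum of `√M`. -/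
theorem sum_sqrt_le_of_weak_type {ι : Type*} [DecidableEq ι] (M : ι → ℝ) {A : ℝ} (hA : 0 ≤ A) :
    ∀ (k : ℕ) (s : Finset ι), s.card = k →
      (∀ r : ℝ, 0 < r → r * (s.filter (fun i => r ≤ M i)).card ≤ A) →
      ∑ i ∈ s, √(M i) ≤ 2 * √(A * k) := by
  intro k
  induction k with
  | zero =>
    intro s hs _
    rw [Finset.card_eq_zero] at hs
    simp [hs]
  | succ k ih =>
    intro s hs hw
    have hne : s.Nonempty := Finset.card_pos.1 (by omega)
    obtain ⟨i₀, hi₀, hmin⟩ := s.exists_min_image M hne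
    have h1 := ih (s.erase i₀) (by rw [Finset.card_erase_of_mem hi₀, hs]; rfl) (by
      intro r hr
      refine le_trans ?_ (hw r hr)
      gcongr
      exact Finset.erase_subset _ _)
    rw [← Finset.add_sum_erase s _ hi₀]
    set m := √(M i₀) with hm
    have hm0 : 0 ≤ m := Real.sqrt_nonneg _
    have h2 : ((k : ℝ) + 1) * m ^ 2 ≤ A := by
      rcases le_or_gt (M i₀) 0 with h | h
      · have : m = 0 := Real.sqrt_eq_zero_of_nonpos h
        simpa [this] using hA
      · have h3 := hw _ h
        rw [Finset.filter_true_of_mem hmin, hs] at h3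
        rw [hm, Real.sq_sqrt h.le]
        push_cast at h3
        linarith
    push_cast
    set a := √(A * (k + 1)) with ha
    set b := √(A * k) with hb
    have ha2 : a ^ 2 = A * (k + 1) := Real.sq_sqrt (by positivity)
    have hb2 : b ^ 2 = A * k := Real.sq_sqrt (by positivity)
    have ha0 : 0 ≤ a := Real.sqrt_nonneg _
    have hb0 : 0 ≤ b := Real.sqrt_nonneg _
    have h4 : ((k : ℝ) + 1) * m ≤ a := by
      refine le_of_sq_le_sq ?_ ha0
      nlinarith [Nat.cast_nonneg (α := ℝ) k]
    have h5 : m ≤ 2 * (a - b) := by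
      by_contra! h
      have hba : b ≤ a := Real.sqrt_le_sqrt (by nlinarith)
      have h6 : 2 * A ≤ 2 * (a - b) * (2 * a) := by nlinarith
      have h7 : 0 ≤ a - b := by linarith
      have h8 : (a - b) * a * 2 * (k + 1) ≥ a ^ 2 := by
        nlinarith [Nat.cast_nonneg (α := ℝ) k]
      rcases ha0.eq_or_lt with h9 | h9
      · nlinarith [Nat.cast_nonneg (α := ℝ) k]
      · have h10 : a ≤ (a - b) * 2 * (k + 1) := by
          by_contra! hcon
          nlinarith
        nlinarith [Nat.cast_nonneg (α := ℝ) k]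
    linarith

/-- The discrete two-sided maximal slope of a sequence on `{0, …, N}`. -/
def maxSlope (F : ℕ → ℝ) (N i : ℕ) : ℝ :=
  (Finset.range (N + 1)).sup' ⟨0, by simp⟩ (fun j => |F j - F i| / |(j : ℝ) - i|)

theorem maxSlope_nonneg (F : ℕ → ℝ) (N i : ℕ) : 0 ≤ maxSlope F N i :=
  (by positivity : 0 ≤ |F 0 - F i| / |((0 : ℕ) : ℝ) - i|).trans
    (Finset.le_sup' (fun j : ℕ => |F j - F i| / |(j : ℝ) - i|) (by simp))

theorem abs_sub_le_maxSlope_mul (F : ℕ → ℝ) (N i j : ℕ) (hj : j ≤ N) :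
    |F j - F i| ≤ maxSlope F N i * |(j : ℝ) - i| := by
  rcases eq_or_ne j i with rfl | hne
  · simp
  have h : (0 : ℝ) < |(j : ℝ) - i| := abs_pos.2 (sub_ne_zero.2 (Nat.cast_injective.ne hne))
  rw [← div_le_iff₀ h]
  exact Finset.le_sup' (fun j : ℕ => |F j - F i| / |(j : ℝ) - i|)
    (Finset.mem_range.2 (Nat.lt_succ_of_le hj))

theorem maxSlope_le {F : ℕ → ℝ} {V : ℝ} (hV : ∀ i j, F j - F i ≤ V) (N i : ℕ) :
    maxSlope F N i ≤ V := by
  have hV0 : 0 ≤ V := by simpa using hV 0 0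
  refine Finset.sup'_le _ _ fun j _ => ?_
  rcases eq_or_ne j i with rfl | hne
  · simpa using hV0
  have h : (1 : ℝ) ≤ |(j : ℝ) - i| := by
    have : (1 : ℤ) ≤ |(j : ℤ) - i| := Int.one_le_abs (by omega)
    exact_mod_cast this
  refine (div_le_self (abs_nonneg _) h).trans (abs_le.2 ⟨?_, hV i j⟩)
  linarith [hV j i]

open scoped Classical in
theorem mul_card_le_maxSlope {F : ℕ → ℝ} (hF : Monotone F) {V : ℝ} (hV : ∀ i j, F j - F i ≤ V)
    (N : ℕ) {r : ℝ} (hr : 0 < r) :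
    r * ((Finset.range (N + 1)).filter (fun i => r ≤ maxSlope F N i)).card ≤ 2 * V := by
  have hsub : (Finset.range (N + 1)).filter (fun i => r ≤ maxSlope F N i) ⊆
      (Finset.Ico 0 N).filter (fun i : ℕ => ∃ j : ℕ, i < j ∧ j ≤ N ∧ r * ((j : ℝ) - i) ≤ F j - F i) ∪
      (Finset.Ioc 0 N).filter (fun i : ℕ => ∃ j : ℕ, j < i ∧ r * ((i : ℝ) - j) ≤ F i - F j) := by
    intro i hi
    obtain ⟨hi1, hi2⟩ := Finset.mem_filter.1 hi
    have hi1 := Finset.mem_range.1 hi1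
    obtain ⟨j, hj, hj2⟩ := (Finset.le_sup'_iff _).1 hi2
    have hj := Finset.mem_range.1 hj
    simp only [Finset.mem_union, Finset.mem_filter, Finset.mem_Ico, Finset.mem_Ioc]
    rcases lt_trichotomy j i with h | rfl | h
    · right
      refine ⟨by omega, j, h, ?_⟩
      have h' : (j : ℝ) < i := Nat.cast_lt.2 h
      rw [abs_sub_comm (F j), abs_sub_comm (j : ℝ), abs_of_pos (sub_pos.2 h'),
        abs_of_nonneg (sub_nonneg.2 (hF h.le)), le_div_iff₀ (sub_pos.2 h')] at hj2
      exact hj2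
    · simp at hj2
      linarith
    · left
      refine ⟨by omega, j, h, by omega, ?_⟩
      have h' : (i : ℝ) < j := Nat.cast_lt.2 h
      rw [abs_of_pos (sub_pos.2 h'),
        abs_of_nonneg (sub_nonneg.2 (hF h.le)), le_div_iff₀ (sub_pos.2 h')] at hj2
      exact hj2
  have h1 := (Finset.card_le_card hsub).trans (Finset.card_union_le _ _)
  have h2 := mul_le_mul_of_nonneg_left (Nat.cast_le (α := ℝ).2 h1) hr.le
  rw [Nat.cast_add, mul_add] at h2
  have h3 := mul_card_right_steep_le hF hr N N 0 (by omega)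
  have h4 := mul_card_left_steep_le hF hr N
  linarith [hV 0 N]

theorem sum_sqrt_maxSlope_le {F : ℕ → ℝ} (hF : Monotone F) {V : ℝ} (hV : ∀ i j, F j - F i ≤ V)
    {N : ℕ} (hN : 1 ≤ N) :
    ∑ i ∈ Finset.range (N + 1), √(maxSlope F N i) ≤ 4 * √V * √N := by
  have hV0 : 0 ≤ V := by simpa using hV 0 0
  refine (sum_sqrt_le_of_weak_type _ (by positivity : (0 : ℝ) ≤ 2 * V) (N + 1) _
    (Finset.card_range _) (fun r hr => mul_card_le_maxSlope hF hV N hr)).trans ?_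
  have : √(2 * V * ((N + 1 : ℕ) : ℝ)) ≤ √(2 ^ 2 * (V * N)) := by
    apply Real.sqrt_le_sqrt
    have : (1 : ℝ) ≤ N := by exact_mod_cast hN
    push_cast
    nlinarith
  rw [Real.sqrt_mul (by norm_num : (0 : ℝ) ≤ 2 ^ 2), Real.sqrt_sq (by norm_num),
    Real.sqrt_mul hV0] at this
  linarith

/-- `O(√N)` nodes suffice for every `i ≤ N` to be within the scale, governed by the maximal slope
of `F` at the node, of one of them. -/
theorem exists_adapted_nodes (V : ℝ) :
    ∃ C K : ℝ, 0 ≤ C ∧ 0 < K ∧ ∀ F : ℕ → ℝ, Monotone F → (∀ i j, F j - F i ≤ V) →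
      ∀ N : ℕ, 1 ≤ N → ∃ S : Finset ℕ, (∀ k ∈ S, k ≤ N) ∧ (S.card : ℝ) ≤ C * √N ∧
        ∀ i ≤ N, ∃ k ∈ S, (|(i : ℝ) - k| + 1) ^ 2 ≤ K * N ∧
          ∀ j ≤ N, (|(i : ℝ) - k| + 1) ^ 2 * |F j - F k| ≤ K * |(j : ℝ) - k| := by
  refine ⟨4 * √V + 3, (2 + √V) ^ 2, by positivity, by positivity, ?_⟩
  intro F hF hV N hN
  have hN' : (1 : ℝ) ≤ N := by exact_mod_cast hN
  have hsN : 1 ≤ √(N : ℝ) := Real.one_le_sqrt.2 hN'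
  have hsN2 : √(N : ℝ) * √(N : ℝ) = N := Real.mul_self_sqrt (by linarith)
  set W : ℕ → ℝ := fun i => √(maxSlope F N i) + 1 / √N with hW
  have hW0 : ∀ i, 0 ≤ W i := fun i => by positivity
  have hWV : ∀ i, W i ≤ √V + 1 := fun i =>
    add_le_add (Real.sqrt_le_sqrt (maxSlope_le hV N i)) ((div_le_one (by linarith)).2 hsN)
  set Φ : ℕ → ℝ := fun i => ∑ j ∈ Finset.range i, W j with hΦ
  have hΦ0 : ∀ i, 0 ≤ Φ i := fun i => Finset.sum_nonneg fun j _ => hW0 j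
  have hΦm : Monotone Φ := monotone_nat_of_le_succ fun i => by
    simp only [hΦ, Finset.sum_range_succ]
    linarith [hW0 i]
  have hΦN : Φ N ≤ (4 * √V + 2) * √N := by
    have h1 : Φ N ≤ Φ (N + 1) := hΦm (Nat.le_succ N)
    have h2 : Φ (N + 1) = ∑ i ∈ Finset.range (N + 1), √(maxSlope F N i) + (N + 1) / √N := by
      simp only [hΦ, hW, Finset.sum_add_distrib, Finset.sum_const, Finset.card_range, nsmul_eq_mul]
      push_cast
      ring
    have h3 : ((N : ℝ) + 1) / √N ≤ 2 * √N := by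
      rw [div_le_iff₀ (by linarith)]
      nlinarith
    linarith [sum_sqrt_maxSlope_le hF hV hN]
  have hnode : ∀ l : ℕ, ∃ k, k ≤ N ∧ ((∃ i ≤ N, ⌊Φ i⌋₊ = l) → ⌊Φ k⌋₊ = l ∧
      ∀ i ≤ N, ⌊Φ i⌋₊ = l → W k ≤ W i) := by
    intro l
    by_cases h : ∃ i ≤ N, ⌊Φ i⌋₊ = l
    · obtain ⟨i, hi, hil⟩ := h
      obtain ⟨k, hk, hmin⟩ := ((Finset.range (N + 1)).filter (fun i => ⌊Φ i⌋₊ = l)).exists_min_image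
        W ⟨i, by simp [hil]; omega⟩
      simp only [Finset.mem_filter, Finset.mem_range] at hk hmin
      exact ⟨k, by omega, fun _ => ⟨hk.2, fun i hi hil => hmin i ⟨by omega, hil⟩⟩⟩
    · exact ⟨0, Nat.zero_le _, fun h' => absurd h' h⟩
  choose node hnodeN hnode using hnode
  refine ⟨(Finset.range (⌊Φ N⌋₊ + 1)).image node, ?_, ?_, ?_⟩
  · intro k hk
    obtain ⟨l, -, rfl⟩ := Finset.mem_image.1 hk
    exact hnodeN l
  · have h1 : (((Finset.range (⌊Φ N⌋₊ + 1)).image node).card : ℝ) ≤ ((⌊Φ N⌋₊ + 1 : ℕ) : ℝ) := by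
      refine Nat.cast_le.2 (Finset.card_image_le.trans ?_)
      rw [Finset.card_range]
    push_cast at h1
    linarith [Nat.floor_le (hΦ0 N)]
  · intro i hi
    obtain ⟨hk1, hk2⟩ := hnode ⌊Φ i⌋₊ ⟨i, hi, rfl⟩
    have hkN := hnodeN ⌊Φ i⌋₊
    have hmem : node ⌊Φ i⌋₊ ∈ (Finset.range (⌊Φ N⌋₊ + 1)).image node :=
      Finset.mem_image_of_mem _ (Finset.mem_range.2
        (Nat.lt_succ_of_le (Nat.floor_le_floor (hΦm hi))))
    set k := node ⌊Φ i⌋₊ with hk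
    have hblock : ∀ a b : ℕ, a ≤ b → b ≤ N → ⌊Φ a⌋₊ = ⌊Φ i⌋₊ → ⌊Φ b⌋₊ = ⌊Φ i⌋₊ →
        ((b : ℝ) - a) * W k ≤ 1 := by
      intro a b hab hbN ha hb
      have h1 : ∑ j ∈ Finset.Ico a b, W j = Φ b - Φ a := Finset.sum_Ico_eq_sub _ hab
      have h2 : (Finset.Ico a b).card • W k ≤ ∑ j ∈ Finset.Ico a b, W j := by
        refine Finset.card_nsmul_le_sum _ _ _ fun j hj => ?_
        obtain ⟨hj1, hj2⟩ := Finset.mem_Ico.1 hj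
        refine hk2 j (by omega) (le_antisymm ?_ ?_)
        · exact hb ▸ Nat.floor_le_floor (hΦm hj2.le)
        · exact ha ▸ Nat.floor_le_floor (hΦm hj1)
      rw [nsmul_eq_mul, Nat.card_Ico, Nat.cast_sub hab, h1] at h2
      have h3 := Nat.lt_floor_add_one (Φ b)
      have h4 := Nat.floor_le (hΦ0 a)
      rw [hb] at h3
      rw [ha] at h4
      linarith
    have hWk : |(i : ℝ) - k| * W k ≤ 1 := by
      rcases le_total i k with h | h
      · have h' : (i : ℝ) ≤ k := Nat.cast_le.2 h
        rw [abs_sub_comm, abs_of_nonneg (sub_nonneg.2 h')]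
        exact hblock i k h hkN rfl hk1
      · have h' : (k : ℝ) ≤ i := Nat.cast_le.2 h
        rw [abs_of_nonneg (sub_nonneg.2 h')]
        exact hblock k i h hi hk1 rfl
    have hmW : (|(i : ℝ) - k| + 1) * W k ≤ 2 + √V := by linarith [hWV k]
    set m := |(i : ℝ) - k| + 1 with hm
    have hm0 : 0 ≤ m := by positivity
    refine ⟨k, hmem, ?_, ?_⟩
    · have h1 : m * (1 / √N) ≤ 2 + √V := le_trans
        (mul_le_mul_of_nonneg_left (by simp [hW]) hm0) hmW
      have h2 : m ≤ (2 + √V) * √N := by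
        rwa [mul_one_div, div_le_iff₀ (by linarith)] at h1
      calc m ^ 2 ≤ ((2 + √V) * √N) ^ 2 := by gcongr
        _ = (2 + √V) ^ 2 * N := by rw [mul_pow, sq √(N : ℝ), hsN2]
    · intro j hj
      have h1 : m * √(maxSlope F N k) ≤ 2 + √V := le_trans
        (mul_le_mul_of_nonneg_left (by simp [hW]) hm0) hmW
      have h2 : m ^ 2 * maxSlope F N k ≤ (2 + √V) ^ 2 := by
        calc m ^ 2 * maxSlope F N k = (m * √(maxSlope F N k)) ^ 2 := by
              rw [mul_pow, Real.sq_sqrt (maxSlope_nonneg F N k)]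
          _ ≤ (2 + √V) ^ 2 := by gcongr
      calc m ^ 2 * |F j - F k| ≤ m ^ 2 * (maxSlope F N k * |(j : ℝ) - k|) := by
            gcongr
            exact abs_sub_le_maxSlope_mul F N k j hj
        _ = m ^ 2 * maxSlope F N k * |(j : ℝ) - k| := by ring
        _ ≤ _ := by gcongr

/-- `Real.cos` is expanding of order two on `[0, π]`. -/
theorem two_mul_sq_sub_le_pi_sq_mul_abs_cos_sub {α β : ℝ} (hα : α ∈ Icc 0 Real.pi)
    (hβ : β ∈ Icc 0 Real.pi) :
    2 * (α - β) ^ 2 ≤ Real.pi ^ 2 * |Real.cos α - Real.cos β| := by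
  wlog h : β ≤ α generalizing α β
  · have := this hβ hα (le_of_not_ge h)
    rwa [abs_sub_comm, ← neg_sub β α, neg_sq]
  have hpi := Real.pi_pos
  obtain ⟨hα0, hα1⟩ := hα
  obtain ⟨hβ0, hβ1⟩ := hβ
  have h1 : 2 / Real.pi * ((α - β) / 2) ≤ Real.sin ((α - β) / 2) :=
    Real.mul_le_sin (by linarith) (by linarith)
  have h2 : Real.sin ((α - β) / 2) ≤ Real.sin ((α + β) / 2) := by
    rcases le_total ((α + β) / 2) (Real.pi / 2) with h | h
    · exact Real.sin_le_sin_of_le_of_le_pi_div_two (by linarith) h (by linarith)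
    · rw [← Real.sin_pi_sub ((α + β) / 2)]
      exact Real.sin_le_sin_of_le_of_le_pi_div_two (by linarith) (by linarith) (by linarith)
  have h3 : 0 ≤ 2 / Real.pi * ((α - β) / 2) :=
    mul_nonneg (by positivity) (by linarith)
  rw [abs_sub_comm, Real.cos_sub_cos]
  have h4 : -2 * Real.sin ((β + α) / 2) * Real.sin ((β - α) / 2) =
      2 * (Real.sin ((α + β) / 2) * Real.sin ((α - β) / 2)) := by
    rw [show (β - α) / 2 = -((α - β) / 2) by ring, Real.sin_neg, add_comm β α]
    ring
  rw [h4]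
  have h5 : (2 / Real.pi * ((α - β) / 2)) * (2 / Real.pi * ((α - β) / 2)) ≤
      Real.sin ((α + β) / 2) * Real.sin ((α - β) / 2) :=
    mul_le_mul (h1.trans h2) h1 h3 (h3.trans (h1.trans h2))
  calc 2 * (α - β) ^ 2 = Real.pi ^ 2 *
        (2 * ((2 / Real.pi * ((α - β) / 2)) * (2 / Real.pi * ((α - β) / 2)))) := by
        field_simp
    _ ≤ Real.pi ^ 2 * (2 * (Real.sin ((α + β) / 2) * Real.sin ((α - β) / 2))) := by gcongr
    _ ≤ _ := by
      gcongr
      exact le_abs_self _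

theorem QuadLip.abs_sub_le_vertical {D : Set (ℝ × ℝ)} {L : ℝ} {P : ℝ × ℝ → ℝ}
    (h : QuadLip D L P) {x f : ℝ} (hf : f ≤ 1) (hD : ∀ y ∈ Icc f 1, (x, y) ∈ D) (α β : ℝ) :
    |P (x, f + (1 - f) * (1 - Real.cos α) / 2) - P (x, f + (1 - f) * (1 - Real.cos β) / 2)| ≤
      L * |α - β| := by
  have key : ∀ t : ℝ, ((x, (f + 1) / 2) : ℝ × ℝ) + t • ((0, -(1 - f) / 2) : ℝ × ℝ) +
      t ^ 2 • (0 : ℝ × ℝ) = (x, f + (1 - f) * (1 - t) / 2) := by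
    intro t
    ext <;> simp
    ring
  have := h (x, (f + 1) / 2) (0, -(1 - f) / 2) 0 (by
    intro t ht
    rw [key]
    exact hD _ ⟨by nlinarith [ht.2], by nlinarith [ht.1]⟩) α β
  rwa [key, key] at this

theorem exists_eq_vertical_param {f y : ℝ} (hf : f < 1) (hy : y ∈ Icc f 1) :
    ∃ α ∈ Icc 0 Real.pi, y = f + (1 - f) * (1 - Real.cos α) / 2 := by
  have h1 : 0 < 1 - f := by linarith
  refine ⟨Real.arccos (1 - 2 * (y - f) / (1 - f)),
    ⟨Real.arccos_nonneg _, Real.arccos_le_pi _⟩, ?_⟩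
  rw [Real.cos_arccos]
  · field_simp
    ring
  · have : 2 * (y - f) / (1 - f) ≤ 2 := by
      rw [div_le_iff₀ h1]
      linarith [hy.2]
    linarith
  · have : 0 ≤ 2 * (y - f) / (1 - f) := div_nonneg (by linarith [hy.1]) h1.le
    linarith

theorem QuadLip.abs_sub_le_vertical_of_abs_sub_le {D : Set (ℝ × ℝ)} {L : ℝ} (hL : 0 ≤ L)
    {P : ℝ × ℝ → ℝ} (h : QuadLip D L P) {x f : ℝ} (hf : f ≤ 1 / 2)
    (hD : ∀ y ∈ Icc f 1, (x, y) ∈ D) {ε : ℝ} (hε : 0 ≤ ε) {y₁ y₂ : ℝ} (h₁ : y₁ ∈ Icc f 1)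
    (h₂ : y₂ ∈ Icc f 1) (h₁₂ : |y₁ - y₂| ≤ ε ^ 2 / 2) :
    |P (x, y₁) - P (x, y₂)| ≤ L * (Real.pi * ε) := by
  obtain ⟨α, hα, rfl⟩ := exists_eq_vertical_param (by linarith) h₁
  obtain ⟨β, hβ, rfl⟩ := exists_eq_vertical_param (by linarith) h₂
  refine (h.abs_sub_le_vertical (by linarith) hD α β).trans ?_
  gcongr
  have h3 := two_mul_sq_sub_le_pi_sq_mul_abs_cos_sub hα hβ
  have h4 : f + (1 - f) * (1 - Real.cos α) / 2 - (f + (1 - f) * (1 - Real.cos β) / 2) =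
      -((1 - f) / 2 * (Real.cos α - Real.cos β)) := by ring
  rw [h4, abs_neg, abs_mul, abs_of_nonneg (by linarith)] at h₁₂
  have h5 : |Real.cos α - Real.cos β| ≤ 2 * ε ^ 2 := by
    nlinarith [abs_nonneg (Real.cos α - Real.cos β)]
  have h6 : Real.pi ^ 2 * |Real.cos α - Real.cos β| ≤ Real.pi ^ 2 * (2 * ε ^ 2) := by gcongr
  have hpi := Real.pi_pos
  refine abs_le_of_sq_le_sq ?_ (by positivity)
  nlinarith

theorem QuadLip.abs_sub_le_parabola {D : Set (ℝ × ℝ)} {L : ℝ} (hL : 0 ≤ L) {P : ℝ × ℝ → ℝ}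
    (h : QuadLip D L P) {x₀ y₀ u v a : ℝ}
    (hD : ∀ t ∈ Icc (-1 : ℝ) 1, (x₀ + t * u, y₀ + t * v + t ^ 2 * a) ∈ D) {t : ℝ}
    (ht : t ∈ Icc (-1 : ℝ) 1) :
    |P (x₀ + t * u, y₀ + t * v + t ^ 2 * a) - P (x₀, y₀)| ≤ L * (Real.pi / 2 * |t|) := by
  have key : ∀ t : ℝ, ((x₀, y₀) : ℝ × ℝ) + t • ((u, v) : ℝ × ℝ) + t ^ 2 • ((0, a) : ℝ × ℝ) =
      (x₀ + t * u, y₀ + t * v + t ^ 2 * a) := by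
    intro t
    ext <;> simp
  have h1 := h (x₀, y₀) (u, v) (0, a) (by
    intro t ht
    rw [key]
    exact hD t ht) (Real.arccos t) (Real.pi / 2)
  rw [key, key, Real.cos_arccos ht.1 ht.2, Real.cos_pi_div_two] at h1
  simp only [zero_mul, add_zero, ne_eq, OfNat.ofNat_ne_zero, not_false_eq_true, zero_pow] at h1
  refine h1.trans ?_
  gcongr
  have h2 : Real.arccos t - Real.pi / 2 = -Real.arcsin t := by
    rw [Real.arccos]
    ring
  rw [h2, abs_neg]
  have h3 := Real.mul_abs_le_abs_sin (x := Real.arcsin t)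
    (abs_le.2 ⟨Real.neg_pi_div_two_le_arcsin t, Real.arcsin_le_pi_div_two t⟩)
  rw [Real.sin_arcsin ht.1 ht.2] at h3
  have hpi := Real.pi_pos
  calc |Real.arcsin t| = Real.pi / 2 * (2 / Real.pi * |Real.arcsin t|) := by field_simp
    _ ≤ _ := by gcongr

/-- The convex function `f`, with subgradient `F` bounded by `Λ`, bounds `D` from below over
`[-1, 1]`, and `D` contains all points of the strip between the graph of `f` and height `1`. -/
structure IsLowerChart (D : Set (ℝ × ℝ)) (f F : ℝ → ℝ) (Λ : ℝ) : Prop where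
  mem : ∀ x ∈ Icc (-1 : ℝ) 1, ∀ y ∈ Icc (f x) 1, (x, y) ∈ D
  le_of_mem : ∀ x ∈ Icc (-1 : ℝ) 1, ∀ y, (x, y) ∈ D → f x ≤ y
  add_le : ∀ x ∈ Icc (-1 : ℝ) 1, ∀ y ∈ Icc (-1 : ℝ) 1, f x + F x * (y - x) ≤ f y
  abs_slope_le : ∀ x ∈ Icc (-1 : ℝ) 1, |F x| ≤ Λ
  le_half : ∀ x ∈ Icc (-1 : ℝ) 1, f x ≤ 1 / 2

/-- Moving a point above the graph of `f` to the vertical line over a nearby node `x₀` at which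
`f` has a good parabolic upper bound. -/
theorem IsLowerChart.abs_sub_le_of_node {D : Set (ℝ × ℝ)} {f F : ℝ → ℝ} {Λ : ℝ}
    (hD : IsLowerChart D f F Λ) {L : ℝ} (hL : 0 ≤ L) {P : ℝ × ℝ → ℝ} (hP : QuadLip D L P)
    {x₀ u σ ε t₀ y : ℝ} (hx₀ : |x₀| ≤ 3 / 4) (hu : 0 ≤ u) (hu8 : u ≤ 1 / 8) (hΛu : Λ * u ≤ 1 / 8)
    (hσ : 0 ≤ σ) (hε : 0 ≤ ε) (hε1 : ε ≤ 1) (hσε : σ ≤ ε ^ 2 / 8)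
    (hf : ∀ t ∈ Icc (-1 : ℝ) 1, f (x₀ + t * u) ≤ f x₀ + σ + t * (F x₀ * u) + t ^ 2 * (1 / 8))
    (ht₀ : |t₀| ≤ ε) (hy : y ≤ 1 / 4) (hfy : f (x₀ + t₀ * u) ≤ y)
    (hfx : f x₀ - f (x₀ + t₀ * u) ≤ 1 / 8) :
    f x₀ + (y - f (x₀ + t₀ * u)) + σ ∈ Icc (f x₀) 1 ∧
      |P (x₀ + t₀ * u, y) - P (x₀, f x₀ + (y - f (x₀ + t₀ * u)) + σ)| ≤ L * (5 * ε) := by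
  obtain ⟨hx1, hx2⟩ := abs_le.1 hx₀
  have hx₀' : x₀ ∈ Icc (-1 : ℝ) 1 := ⟨by linarith, by linarith⟩
  have hε2 : ε ^ 2 ≤ 1 := by nlinarith
  have hmem : ∀ t ∈ Icc (-1 : ℝ) 1, x₀ + t * u ∈ Icc (-1 : ℝ) 1 := by
    intro t ht
    exact ⟨by nlinarith [ht.1], by nlinarith [ht.2]⟩
  have ht₀' : t₀ ∈ Icc (-1 : ℝ) 1 := abs_le.1 (ht₀.trans hε1)
  have hΛ : |F x₀ * u| ≤ 1 / 8 := by
    rw [abs_mul, abs_of_nonneg hu]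
    exact (mul_le_mul_of_nonneg_right (hD.abs_slope_le _ hx₀') hu).trans hΛu
  set s := y - f (x₀ + t₀ * u) with hs
  have hs0 : 0 ≤ s := by linarith
  have hle : ∀ t ∈ Icc (-1 : ℝ) 1,
      f x₀ + s + σ + t * (F x₀ * u) + t ^ 2 * (1 / 8) ≤ 1 := by
    intro t ht
    have h1 : t * (F x₀ * u) ≤ 1 / 8 := by
      have h1 := le_abs_self (t * (F x₀ * u))
      rw [abs_mul] at h1
      have h2 := abs_le.2 ht
      nlinarith [abs_nonneg t, abs_nonneg (F x₀ * u)]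
    have h2 : t ^ 2 ≤ 1 := by nlinarith [ht.1, ht.2]
    linarith
  have hpar : ∀ t ∈ Icc (-1 : ℝ) 1,
      (x₀ + t * u, f x₀ + s + σ + t * (F x₀ * u) + t ^ 2 * (1 / 8)) ∈ D := by
    intro t ht
    exact hD.mem _ (hmem t ht) _ ⟨by linarith [hf t ht], hle t ht⟩
  refine ⟨⟨by linarith, ?_⟩, ?_⟩
  · simpa using hle 0 (by simp)
  have h1 := hP.abs_sub_le_parabola hL hpar ht₀'
  have hsq : t₀ ^ 2 ≤ ε ^ 2 := sq_le_sq' (by linarith [(abs_le.1 ht₀).1])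
    (by linarith [(abs_le.1 ht₀).2])
  have hsub := hD.add_le x₀ hx₀' _ (hmem t₀ ht₀')
  rw [add_sub_cancel_left] at hsub
  have h2 := hP.abs_sub_le_vertical_of_abs_sub_le hL (hD.le_half _ (hmem t₀ ht₀'))
    (hD.mem _ (hmem t₀ ht₀')) hε (y₁ := y)
    (y₂ := f x₀ + s + σ + t₀ * (F x₀ * u) + t₀ ^ 2 * (1 / 8)) ⟨hfy, by linarith⟩
    ⟨by linarith [hf t₀ ht₀'], hle t₀ ht₀'⟩
    (abs_le.2 ⟨by nlinarith, by linarith [hf t₀ ht₀', sq_nonneg ε]⟩)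
  have h3 := abs_sub_le (P (x₀ + t₀ * u, y))
    (P (x₀ + t₀ * u, f x₀ + s + σ + t₀ * (F x₀ * u) + t₀ ^ 2 * (1 / 8)))
    (P (x₀, f x₀ + s + σ))
  have h4 : L * (Real.pi / 2 * |t₀|) ≤ L * (Real.pi / 2 * ε) := by
    have := Real.pi_pos
    gcongr
  have h5 : L * (Real.pi * ε + Real.pi / 2 * ε) ≤ L * (5 * ε) := by
    gcongr
    nlinarith [Real.pi_lt_d2]
  rw [mul_add] at h5
  linarith

theorem IsLowerChart.monotoneOn {D : Set (ℝ × ℝ)} {f F : ℝ → ℝ} {Λ : ℝ}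
    (hD : IsLowerChart D f F Λ) : MonotoneOn F (Icc (-1) 1) := by
  intro x hx y hy hxy
  rcases hxy.eq_or_lt with rfl | hlt
  · rfl
  have h1 := hD.add_le x hx y hy
  have h2 := hD.add_le y hy x hx
  by_contra! h
  nlinarith

/-- The slopes `F` sampled on the grid `-1 + j h`, constant beyond the point `1`. -/
def sampledSlope (F : ℝ → ℝ) (h : ℝ) (j : ℕ) : ℝ := F (min (-1 + j * h) 1)

theorem sampledSlope_arg_mem {h : ℝ} (hh : 0 ≤ h) (j : ℕ) :
    min (-1 + j * h) 1 ∈ Icc (-1 : ℝ) 1 :=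
  ⟨le_min (by linarith [mul_nonneg (Nat.cast_nonneg (α := ℝ) j) hh]) (by norm_num),
    min_le_right _ _⟩

theorem IsLowerChart.monotone_sampledSlope {D : Set (ℝ × ℝ)} {f F : ℝ → ℝ} {Λ : ℝ}
    (hD : IsLowerChart D f F Λ) {h : ℝ} (hh : 0 ≤ h) : Monotone (sampledSlope F h) := by
  intro i j hij
  refine hD.monotoneOn (sampledSlope_arg_mem hh i) (sampledSlope_arg_mem hh j) ?_
  gcongr

theorem IsLowerChart.sampledSlope_sub_le {D : Set (ℝ × ℝ)} {f F : ℝ → ℝ} {Λ : ℝ}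
    (hD : IsLowerChart D f F Λ) {h : ℝ} (hh : 0 ≤ h) (i j : ℕ) :
    sampledSlope F h j - sampledSlope F h i ≤ 2 * Λ := by
  have h1 := abs_le.1 (hD.abs_slope_le _ (sampledSlope_arg_mem hh i))
  have h2 := abs_le.1 (hD.abs_slope_le _ (sampledSlope_arg_mem hh j))
  unfold sampledSlope
  linarith [h1.1, h2.2]

theorem sampledSlope_of_le (F : ℝ → ℝ) {h : ℝ} {N : ℕ} (hh : 0 ≤ h) (hN : N * h = 2) {j : ℕ}
    (hj : j ≤ N) : sampledSlope F h j = F (-1 + j * h) ∧ -1 + j * h ∈ Icc (-1 : ℝ) 1 := by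
  have h1 : (j : ℝ) * h ≤ N * h := by gcongr
  have h2 : 0 ≤ (j : ℝ) * h := by positivity
  refine ⟨?_, by linarith, by linarith⟩
  rw [sampledSlope, min_eq_left (by linarith)]

/-- At a node the discrete slope bound yields a bound for the variation of `F` around it. -/
theorem IsLowerChart.sq_mul_abs_slope_sub_le {D : Set (ℝ × ℝ)} {f F : ℝ → ℝ} {Λ : ℝ}
    (hD : IsLowerChart D f F Λ) {h : ℝ} {N : ℕ} (hh : 0 < h) (hN : N * h = 2)
    {k : ℕ} (hk : k ≤ N) {m K : ℝ} (hK : 0 ≤ K)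
    (hm : ∀ j ≤ N, m ^ 2 * |sampledSlope F h j - sampledSlope F h k| ≤ K * |(j : ℝ) - k|)
    {x : ℝ} (hx : x ∈ Icc (-1 : ℝ) 1) :
    m ^ 2 * |F x - F (-1 + k * h)| ≤ K * (|x - (-1 + k * h)| / h + 1) := by
  obtain ⟨hFk, hxk⟩ := sampledSlope_of_le F hh.le hN hk
  set x₀ := -1 + k * h with hx₀
  set ξ := (x + 1) / h with hξ
  have hξ0 : 0 ≤ ξ := div_nonneg (by linarith [hx.1]) hh.le
  have hξN : ξ ≤ N := by
    rw [hξ, div_le_iff₀ hh, hN]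
    linarith [hx.2]
  have hxξ : x = -1 + ξ * h := by
    rw [hξ]
    field_simp
    ring
  have hdiv : |x - x₀| / h = |ξ - k| := by
    rw [hxξ, hx₀, show -1 + ξ * h - (-1 + k * h) = (ξ - k) * h by ring, abs_mul, abs_of_pos hh]
    field_simp
  rw [hdiv]
  have key : ∃ j ≤ N, |F x - F x₀| ≤ |sampledSlope F h j - sampledSlope F h k| ∧
      |(j : ℝ) - k| ≤ |ξ - k| + 1 := by
    rcases le_total (k : ℝ) ξ with hle | hle
    · have hj : ⌈ξ⌉₊ ≤ N := Nat.ceil_le.2 hξN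
      have hj1 := Nat.le_ceil ξ
      have hj2 := Nat.ceil_lt_add_one hξ0
      obtain ⟨hFj, hxj⟩ := sampledSlope_of_le F hh.le hN hj
      refine ⟨⌈ξ⌉₊, hj, ?_, ?_⟩
      · have h1 : F x₀ ≤ F x := hD.monotoneOn hxk hx (by rw [hxξ, hx₀]; gcongr)
        have h2 : F x ≤ F (-1 + ⌈ξ⌉₊ * h) := hD.monotoneOn hx hxj (by
          nth_rewrite 1 [hxξ]
          gcongr)
        rw [hFj, hFk, abs_of_nonneg (by linarith), abs_of_nonneg (by linarith)]
        linarith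
      · rw [abs_of_nonneg (by linarith), abs_of_nonneg (by linarith)]
        linarith
    · have hj1 := Nat.floor_le hξ0
      have hj2 := Nat.lt_floor_add_one ξ
      have hj : ⌊ξ⌋₊ ≤ N := by exact_mod_cast hj1.trans hξN
      obtain ⟨hFj, hxj⟩ := sampledSlope_of_le F hh.le hN hj
      refine ⟨⌊ξ⌋₊, hj, ?_, ?_⟩
      · have h1 : F x ≤ F x₀ := hD.monotoneOn hx hxk (by rw [hxξ, hx₀]; gcongr)
        have h2 : F (-1 + ⌊ξ⌋₊ * h) ≤ F x := hD.monotoneOn hxj hx (by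
          have := mul_le_mul_of_nonneg_right hj1 hh.le
          linarith)
        rw [hFj, hFk, abs_of_nonpos (by linarith), abs_of_nonpos (by linarith)]
        linarith
      · rw [abs_of_nonpos (by linarith), abs_of_nonpos (by linarith)]
        linarith
  obtain ⟨j, hj, h1, h2⟩ := key
  calc m ^ 2 * |F x - F x₀| ≤ m ^ 2 * |sampledSlope F h j - sampledSlope F h k| := by gcongr
    _ ≤ K * |(j : ℝ) - k| := hm j hj
    _ ≤ _ := by gcongr

/-- At a node the discrete slope bound yields a parabolic upper bound of `f`. -/
theorem IsLowerChart.le_parabola {D : Set (ℝ × ℝ)} {f F : ℝ → ℝ} {Λ : ℝ}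
    (hD : IsLowerChart D f F Λ) {h : ℝ} {N : ℕ} (hh : 0 < h) (hN : N * h = 2)
    {k : ℕ} (hk : k ≤ N) {m K κ : ℝ} (hK : 0 ≤ K) (hm0 : 0 < m)
    (hm : ∀ j ≤ N, m ^ 2 * |sampledSlope F h j - sampledSlope F h k| ≤ K * |(j : ℝ) - k|)
    (hκ : 2 * K * κ ^ 2 ≤ 1 / 8) {t : ℝ}
    (hx : -1 + k * h + t * (m * √h * κ) ∈ Icc (-1 : ℝ) 1) :
    f (-1 + k * h + t * (m * √h * κ)) ≤ f (-1 + k * h) + 2 * Λ * h +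
      t * (F (-1 + k * h) * (m * √h * κ)) + t ^ 2 * (1 / 8) := by
  have hkey := hD.sq_mul_abs_slope_sub_le hh hN hk hK hm hx
  obtain ⟨-, hxk⟩ := sampledSlope_of_le F hh.le hN hk
  rw [add_sub_cancel_left] at hkey
  set x₀ := -1 + k * h with hx₀
  set w := t * (m * √h * κ) with hw
  have hw2 : w ^ 2 = t ^ 2 * m ^ 2 * κ ^ 2 * h := by
    rw [hw]
    calc (t * (m * √h * κ)) ^ 2 = t ^ 2 * m ^ 2 * κ ^ 2 * √h ^ 2 := by ring
      _ = _ := by rw [Real.sq_sqrt hh.le]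
  have h1 := hD.add_le (x₀ + w) hx x₀ hxk
  have h2 : (F (x₀ + w) - F x₀) * w ≤ |F (x₀ + w) - F x₀| * |w| := by
    rw [← abs_mul]
    exact le_abs_self _
  have h3 : |F (x₀ + w) - F x₀| * |w| ≤ 2 * Λ * h + t ^ 2 * (1 / 8) := by
    rcases le_total |w| h with hwh | hwh
    · have h4 : |F (x₀ + w) - F x₀| ≤ 2 * Λ := by
        have e1 := abs_le.1 (hD.abs_slope_le _ hx)
        have e2 := abs_le.1 (hD.abs_slope_le _ hxk)
        exact abs_le.2 ⟨by linarith [e1.1, e2.2], by linarith [e1.2, e2.1]⟩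
      have h5 : |F (x₀ + w) - F x₀| * |w| ≤ 2 * Λ * h :=
        mul_le_mul h4 hwh (abs_nonneg _) ((abs_nonneg _).trans h4)
      linarith [sq_nonneg t]
    · have hΛ : 0 ≤ Λ := (abs_nonneg _).trans (hD.abs_slope_le _ hx)
      have h4 : |w| / h + 1 ≤ 2 * |w| / h := by
        rw [div_add_one hh.ne']
        gcongr
        linarith
      have h5 : m ^ 2 * (|F (x₀ + w) - F x₀| * |w|) ≤ m ^ 2 * (t ^ 2 * (1 / 8)) := by
        calc m ^ 2 * (|F (x₀ + w) - F x₀| * |w|) = m ^ 2 * |F (x₀ + w) - F x₀| * |w| := by ring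
          _ ≤ K * (|w| / h + 1) * |w| := by gcongr
          _ ≤ K * (2 * |w| / h) * |w| := by gcongr
          _ = 2 * K / h * |w| ^ 2 := by ring
          _ = 2 * K * κ ^ 2 * (m ^ 2 * t ^ 2) := by
            rw [sq_abs, hw2]
            field_simp
          _ ≤ 1 / 8 * (m ^ 2 * t ^ 2) := by gcongr
          _ = _ := by ring
      have h6 := le_of_mul_le_mul_left h5 (by positivity)
      linarith [mul_nonneg (mul_nonneg zero_le_two hΛ) hh.le]
  linarith

set_option maxHeartbeats 1000000 in
theorem IsLowerChart.exists_node {D : Set (ℝ × ℝ)} {f F : ℝ → ℝ} {Λ : ℝ}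
    (hD : IsLowerChart D f F Λ) (hΛ : 0 ≤ Λ) :
    ∃ C : ℝ, 0 ≤ C ∧ ∀ ε : ℝ, 0 < ε → ε ≤ 1 → ∃ S : Finset ℝ,
      (∀ x ∈ S, x ∈ Icc (-1 : ℝ) 1) ∧ (S.card : ℝ) ≤ C / ε ∧
      ∀ x y, |x| ≤ 1 / 2 → y ≤ 1 / 4 → f x ≤ y → ∃ x₀ ∈ S, ∃ y₀ ∈ Icc (f x₀) 1,
        ∀ L : ℝ, 0 ≤ L → ∀ P, QuadLip D L P → |P (x, y) - P (x₀, y₀)| ≤ L * (5 * ε) := by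
  obtain ⟨C, K, hC, hK, hnodes⟩ := exists_adapted_nodes (2 * Λ)
  set κ : ℝ := √(1 / (128 * K * (1 + Λ) ^ 2)) with hκ
  have hκ2 : κ ^ 2 = 1 / (128 * K * (1 + Λ) ^ 2) := Real.sq_sqrt (by positivity)
  have hκ0 : 0 < κ := Real.sqrt_pos.2 (by positivity)
  have hκK : 2 * K * κ ^ 2 * (1 + Λ) ^ 2 = 1 / 64 := by
    rw [hκ2]
    field_simp
    norm_num
  have hΛ1 : 1 ≤ (1 + Λ) ^ 2 := by nlinarith
  set η : ℝ := min (κ ^ 2) (1 / (16 * (1 + Λ))) with hη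
  have hη0 : 0 < η := lt_min (by positivity) (by positivity)
  have hη1 : η ≤ κ ^ 2 := min_le_left _ _
  have hη2 : η * (16 * (1 + Λ)) ≤ 1 := by
    rw [← le_div_iff₀ (by positivity)]
    exact min_le_right _ _
  refine ⟨C * √(3 / η), by positivity, fun ε hε hε1 => ?_⟩
  have hε2 : ε ^ 2 ≤ 1 := by nlinarith
  set N : ℕ := ⌈2 / (η * ε ^ 2)⌉₊ with hN
  have hNge : 2 / (η * ε ^ 2) ≤ N := Nat.le_ceil _
  have hN0 : (0 : ℝ) < N := lt_of_lt_of_le (by positivity) hNge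
  have hNle : (N : ℝ) ≤ 3 / (η * ε ^ 2) := by
    have h1 : (N : ℝ) < 2 / (η * ε ^ 2) + 1 := Nat.ceil_lt_add_one (by positivity)
    have h2 : 1 ≤ 1 / (η * ε ^ 2) := by
      rw [one_le_div (by positivity)]
      nlinarith
    have h3 : 3 / (η * ε ^ 2) = 2 / (η * ε ^ 2) + 1 / (η * ε ^ 2) := by ring
    linarith
  set h : ℝ := 2 / N with hh
  have hh0 : 0 < h := by positivity
  have hNh : N * h = 2 := by
    rw [hh]
    field_simp
  have hhε : h ≤ η * ε ^ 2 := by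
    rw [hh, div_le_iff₀ hN0]
    rwa [div_le_iff₀ (by positivity), mul_comm] at hNge
  have hhη : h ≤ η := hhε.trans (by nlinarith)
  have hsh2 : √h ^ 2 = h := Real.sq_sqrt hh0.le
  have hsh : √h ≤ κ * ε := by
    rw [← Real.sqrt_sq (by positivity : 0 ≤ κ * ε)]
    apply Real.sqrt_le_sqrt
    rw [mul_pow]
    exact hhε.trans (by gcongr)
  obtain ⟨S, hSN, hScard, hS⟩ := hnodes (sampledSlope F h) (hD.monotone_sampledSlope hh0.le)
    (hD.sampledSlope_sub_le hh0.le) N (by exact_mod_cast hN0)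
  refine ⟨S.image (fun k : ℕ => -1 + (k : ℝ) * h), ?_, ?_, ?_⟩
  · intro x hx
    obtain ⟨k, hk, rfl⟩ := Finset.mem_image.1 hx
    exact (sampledSlope_of_le F hh0.le hNh (hSN k hk)).2
  · calc ((S.image (fun k : ℕ => -1 + (k : ℝ) * h)).card : ℝ) ≤ S.card :=
        Nat.cast_le.2 Finset.card_image_le
      _ ≤ C * √N := hScard
      _ ≤ C * √(3 / (η * ε ^ 2)) := by gcongr
      _ = C * √(3 / η) / ε := by
        rw [← div_div, Real.sqrt_div (by positivity), Real.sqrt_sq hε.le, mul_div_assoc]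
  · intro x y hx hy hfy
    obtain ⟨hx1, hx2⟩ := abs_le.1 hx
    set ξ := (x + 1) / h with hξ
    have hξ0 : 0 ≤ ξ := div_nonneg (by linarith) hh0.le
    have hξN : ξ ≤ N := by
      rw [hξ, div_le_iff₀ hh0, hNh]
      linarith
    have hxξ : x = -1 + ξ * h := by
      rw [hξ]
      field_simp
      ring
    have hi1 := Nat.floor_le hξ0
    have hi2 := Nat.lt_floor_add_one ξ
    obtain ⟨k, hkS, hmK, hm⟩ := hS ⌊ξ⌋₊ (by exact_mod_cast hi1.trans hξN)
    set m := |(⌊ξ⌋₊ : ℝ) - k| + 1 with hmdef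
    have hm1 : 1 ≤ m := by
      have := abs_nonneg ((⌊ξ⌋₊ : ℝ) - k)
      linarith
    have hξk : |ξ - k| ≤ m := by
      have h1 := abs_sub_le ξ ⌊ξ⌋₊ k
      have h2 : |ξ - ⌊ξ⌋₊| ≤ 1 := abs_le.2 ⟨by linarith, by linarith⟩
      linarith
    have hkN := hSN k hkS
    obtain ⟨-, hxk⟩ := sampledSlope_of_le F hh0.le hNh hkN
    set x₀ := -1 + (k : ℝ) * h with hx₀
    set u := m * √h * κ with hu
    have hu0 : 0 < u := by positivity
    have hmh : m ^ 2 * h ≤ 2 * K := by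
      calc m ^ 2 * h ≤ K * N * h := by gcongr
        _ = 2 * K := by rw [mul_assoc, hNh]; ring
    have hu2 : (u * (1 + Λ)) ^ 2 ≤ (1 / 8) ^ 2 := by
      calc (u * (1 + Λ)) ^ 2 = m ^ 2 * √h ^ 2 * κ ^ 2 * (1 + Λ) ^ 2 := by rw [hu]; ring
        _ ≤ 2 * K * κ ^ 2 * (1 + Λ) ^ 2 := by
          rw [hsh2]
          gcongr
        _ = (1 / 8) ^ 2 := by rw [hκK]; norm_num
    have hu8 : u * (1 + Λ) ≤ 1 / 8 := le_of_sq_le_sq hu2 (by norm_num)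
    have hu8' : u ≤ 1 / 8 :=
      (le_mul_of_one_le_right hu0.le (by linarith)).trans hu8
    have hr : |x - x₀| ≤ u * ε := by
      rw [hxξ, hx₀, show -1 + ξ * h - (-1 + k * h) = (ξ - k) * h by ring, abs_mul, abs_of_pos hh0]
      calc |ξ - k| * h ≤ m * h := by gcongr
        _ = m * √h * √h := by rw [mul_assoc, ← sq, hsh2]
        _ ≤ m * √h * (κ * ε) := by gcongr
        _ = u * ε := by rw [hu]; ring
    have hru : |x - x₀| ≤ u := hr.trans (mul_le_of_le_one_right hu0.le hε1)
    obtain ⟨hr1, hr2⟩ := abs_le.1 hru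
    have ht₀ : x₀ + (x - x₀) / u * u = x := by
      field_simp
      ring
    have hx₀' : |x₀| ≤ 3 / 4 := abs_le.2 ⟨by linarith, by linarith⟩
    have hpar : ∀ t ∈ Icc (-1 : ℝ) 1,
        f (x₀ + t * u) ≤ f x₀ + 2 * Λ * h + t * (F x₀ * u) + t ^ 2 * (1 / 8) := by
      intro t ht
      refine hD.le_parabola hh0 hNh hkN hK.le (by linarith) hm ?_ ?_
      · have h1 := le_mul_of_one_le_right (by positivity : 0 ≤ 2 * K * κ ^ 2) hΛ1
        linarith
      · obtain ⟨e1, e2⟩ := abs_le.1 hx₀'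
        have h1 := mul_le_mul_of_nonneg_right ht.1 hu0.le
        have h2 := mul_le_mul_of_nonneg_right ht.2 hu0.le
        exact ⟨by linarith, by linarith⟩
    have hlip : f x₀ - f x ≤ 1 / 8 := by
      have h1 := hD.add_le x₀ hxk x ⟨by linarith, by linarith⟩
      have h2 : -(F x₀ * (x - x₀)) ≤ Λ * u := by
        have h3 := neg_abs_le (F x₀ * (x - x₀))
        rw [abs_mul] at h3
        have h4 := mul_le_mul (hD.abs_slope_le _ hxk) hru (abs_nonneg _) hΛ
        linarith
      have h5 : Λ * u ≤ u * (1 + Λ) := by linarith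
      linarith
    have hmain : ∀ L : ℝ, 0 ≤ L → ∀ P : ℝ × ℝ → ℝ, QuadLip D L P →
        f x₀ + (y - f x) + 2 * Λ * h ∈ Icc (f x₀) 1 ∧
        |P (x, y) - P (x₀, f x₀ + (y - f x) + 2 * Λ * h)| ≤ L * (5 * ε) := by
      intro L hL P hP
      have hfin := hD.abs_sub_le_of_node hL hP (σ := 2 * Λ * h) (t₀ := (x - x₀) / u) (y := y)
        (ε := ε) hx₀' hu0.le hu8' (by linarith) (by positivity) hε.le hε1 (by
          calc 2 * Λ * h ≤ 2 * Λ * (η * ε ^ 2) := by gcongr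
            _ = (2 * Λ * η) * ε ^ 2 := by ring
            _ ≤ (1 / 8) * ε ^ 2 := by
              gcongr
              linarith [mul_comm Λ η]
            _ = ε ^ 2 / 8 := by ring) hpar (by
          rw [abs_div, abs_of_pos hu0, div_le_iff₀ hu0]
          linarith) hy (by rwa [ht₀]) (by rwa [ht₀])
      rwa [ht₀] at hfin
    refine ⟨x₀, Finset.mem_image_of_mem _ hkS, f x₀ + (y - f x) + 2 * Λ * h, ?_, fun L hL P hP =>
      (hmain L hL P hP).2⟩
    exact (hmain 0 le_rfl (fun _ => 0) (fun a b c _ α β => by simp)).1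

theorem IsLowerChart.exists_mesh {D : Set (ℝ × ℝ)} {f F : ℝ → ℝ} {Λ : ℝ}
    (hD : IsLowerChart D f F Λ) (hΛ : 0 ≤ Λ) :
    ∃ C : ℝ, 0 ≤ C ∧ ∀ ε : ℝ, 0 < ε → ε ≤ 1 → ∃ Y : Finset (ℝ × ℝ),
      ↑Y ⊆ D ∧ (Y.card : ℝ) ≤ C / ε ^ 2 ∧
      ∀ x y, |x| ≤ 1 / 2 → y ≤ 1 / 4 → (x, y) ∈ D → ∃ q ∈ Y,
        ∀ L : ℝ, 0 ≤ L → ∀ P, QuadLip D L P → |P (x, y) - P q| ≤ L * (6 * ε) := by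
  obtain ⟨C, hC, hnode⟩ := hD.exists_node hΛ
  refine ⟨C * 5, by positivity, fun ε hε hε1 => ?_⟩
  obtain ⟨S, hS1, hScard, hS⟩ := hnode ε hε hε1
  refine ⟨(S ×ˢ Finset.range (⌊Real.pi / ε⌋₊ + 1)).image (fun q =>
    (q.1, f q.1 + (1 - f q.1) * (1 - Real.cos (q.2 * ε)) / 2)), ?_, ?_, ?_⟩
  · intro q hq
    obtain ⟨⟨x, j⟩, hxj, rfl⟩ := Finset.mem_image.1 (Finset.mem_coe.1 hq)
    have hx := hS1 x (Finset.mem_product.1 hxj).1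
    have h1 := hD.le_half x hx
    refine hD.mem x hx _ ⟨?_, ?_⟩
    · nlinarith [Real.cos_le_one (j * ε)]
    · nlinarith [Real.neg_one_le_cos (j * ε)]
  · refine (Nat.cast_le.2 Finset.card_image_le).trans ?_
    rw [Finset.card_product, Finset.card_range, Nat.cast_mul]
    have h1 : ((⌊Real.pi / ε⌋₊ + 1 : ℕ) : ℝ) ≤ 5 / ε := by
      have h2 := Nat.floor_le (a := Real.pi / ε) (by have := Real.pi_pos; positivity)
      have h3 : Real.pi / ε + 1 ≤ 5 / ε := by
        rw [div_add_one hε.ne']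
        gcongr
        linarith [Real.pi_lt_d2]
      push_cast
      linarith
    calc (S.card : ℝ) * ((⌊Real.pi / ε⌋₊ + 1 : ℕ) : ℝ) ≤ C / ε * (5 / ε) := by gcongr
      _ = _ := by ring
  · intro x y hx hy hxy
    have hx' : x ∈ Icc (-1 : ℝ) 1 := by
      obtain ⟨h1, h2⟩ := abs_le.1 hx
      exact ⟨by linarith, by linarith⟩
    obtain ⟨x₀, hx₀, y₀, hy₀, hP₀⟩ := hS x y hx hy (hD.le_of_mem x hx' y hxy)
    have hx₀' := hS1 x₀ hx₀
    have hhalf := hD.le_half x₀ hx₀'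
    obtain ⟨α, hα, hyα⟩ := exists_eq_vertical_param (by linarith) hy₀
    have hαε : 0 ≤ α / ε := div_nonneg hα.1 hε.le
    have hmem : (x₀, ⌊α / ε⌋₊) ∈ S ×ˢ Finset.range (⌊Real.pi / ε⌋₊ + 1) :=
      Finset.mem_product.2 ⟨hx₀, Finset.mem_range.2
        (Nat.lt_succ_of_le (Nat.floor_le_floor (div_le_div_of_nonneg_right hα.2 hε.le)))⟩
    refine ⟨_, Finset.mem_image_of_mem _ hmem, ?_⟩
    intro L hL P hP
    have h1 := hP₀ L hL P hP
    have h2 := hP.abs_sub_le_vertical (by linarith) (hD.mem x₀ hx₀') α (⌊α / ε⌋₊ * ε)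
    have h3 : |α - ⌊α / ε⌋₊ * ε| ≤ ε := by
      have e1 := Nat.floor_le hαε
      have e2 := Nat.lt_floor_add_one (α / ε)
      rw [le_div_iff₀ hε] at e1
      rw [div_lt_iff₀ hε] at e2
      exact abs_le.2 ⟨by linarith, by linarith⟩
    have h4 : L * |α - ⌊α / ε⌋₊ * ε| ≤ L * ε := by gcongr
    rw [← hyα] at h2
    refine (abs_sub_le _ (P (x₀, y₀)) _).trans ?_
    linarith

theorem ConvexOn.exists_subgradient {s : Set ℝ} {f : ℝ → ℝ} (hf : ConvexOn ℝ s f) {x a b : ℝ}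
    (ha : a ∈ s) (hb : b ∈ s) (hx : x ∈ s) (hax : a < x) (hxb : x < b) :
    ∃ m : ℝ, ∀ y ∈ s, f x + m * (y - x) ≤ f y := by
  have hslope : ∀ u ∈ s, u < x → ∀ v ∈ s, x < v →
      (f x - f u) / (x - u) ≤ (f v - f x) / (v - x) :=
    fun u hu hux v hv hxv => hf.slope_mono_adjacent hu hv hux hxv
  set T : Set ℝ := (fun u => (f x - f u) / (x - u)) '' {u ∈ s | u < x} with hT
  have hne : T.Nonempty := ⟨_, a, ⟨ha, hax⟩, rfl⟩
  have hle : ∀ v ∈ s, x < v → ∀ r ∈ T, r ≤ (f v - f x) / (v - x) := by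
    rintro v hv hxv _ ⟨u, ⟨hu, hux⟩, rfl⟩
    exact hslope u hu hux v hv hxv
  refine ⟨sSup T, fun y hy => ?_⟩
  rcases lt_trichotomy y x with h | rfl | h
  · have h1 : (f x - f y) / (x - y) ≤ sSup T := le_csSup ⟨_, hle b hb hxb⟩ ⟨y, ⟨hy, h⟩, rfl⟩
    rw [div_le_iff₀ (by linarith)] at h1
    linarith
  · simp
  · have h1 : sSup T ≤ (f y - f x) / (y - x) := csSup_le hne (hle y hy h)
    rw [le_div_iff₀ (by linarith)] at h1
    linarith

/-- The lower boundary of a compact convex set containing the origin and the segment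
`[-2, 2] × {1}` is a lower chart. -/
theorem exists_isLowerChart {D : Set (ℝ × ℝ)} (hconv : Convex ℝ D) (hcomp : IsCompact D)
    (h0 : ((0 : ℝ), (0 : ℝ)) ∈ D) (h1 : ∀ w ∈ Icc (-2 : ℝ) 2, (w, (1 : ℝ)) ∈ D) :
    ∃ (f F : ℝ → ℝ) (Λ : ℝ), 0 ≤ Λ ∧ IsLowerChart D f F Λ := by
  obtain ⟨H, hH⟩ := hcomp.isBounded.exists_norm_le
  have hH' : ∀ x y, (x, y) ∈ D → |y| ≤ H := fun x y hxy => (norm_snd_le (x, y)).trans (hH _ hxy)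
  have hH0 : 0 ≤ H := (norm_nonneg _).trans (hH _ h0)
  set f : ℝ → ℝ := fun w => sInf {y | (w, y) ∈ D} with hf
  have hbdd : ∀ w, BddBelow {y | (w, y) ∈ D} := fun w =>
    ⟨-H, fun y hy => (abs_le.1 (hH' w y hy)).1⟩
  have hfle : ∀ w y, (w, y) ∈ D → f w ≤ y := fun w y hy => csInf_le (hbdd w) hy
  have hfmem : ∀ w ∈ Icc (-2 : ℝ) 2, (w, f w) ∈ D := fun w hw =>
    IsClosed.csInf_mem (hcomp.isClosed.preimage (by fun_prop : Continuous fun y : ℝ => (w, y)))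
      ⟨1, h1 w hw⟩ (hbdd w)
  have hfconv : ConvexOn ℝ (Icc (-2 : ℝ) 2) f :=
    ⟨convex_Icc _ _, fun x hx y hy a b ha hb hab =>
      hfle _ _ (hconv (hfmem x hx) (hfmem y hy) ha hb hab)⟩
  have hsub : ∀ x : ℝ, ∃ m : ℝ, x ∈ Icc (-1 : ℝ) 1 →
      ∀ y ∈ Icc (-2 : ℝ) 2, f x + m * (y - x) ≤ f y := by
    intro x
    by_cases hx : x ∈ Icc (-1 : ℝ) 1
    · obtain ⟨m, hm⟩ := hfconv.exists_subgradient (x := x) (a := -2) (b := 2) (by norm_num)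
        (by norm_num) ⟨by linarith [hx.1], by linarith [hx.2]⟩ (by linarith [hx.1])
        (by linarith [hx.2])
      exact ⟨m, fun _ => hm⟩
    · exact ⟨0, fun h => absurd h hx⟩
  choose F hF using hsub
  have hmem2 : ∀ x ∈ Icc (-1 : ℝ) 1, x ∈ Icc (-2 : ℝ) 2 := fun x hx =>
    ⟨by linarith [hx.1], by linarith [hx.2]⟩
  refine ⟨f, F, 1 + H, by linarith, ?_, ?_, ?_, ?_, ?_⟩
  · intro x hx y hy
    have hx2 := hmem2 x hx
    have hc : Convex ℝ {y | (x, y) ∈ D} := fun y hy z hz a b ha hb hab => by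
      have := hconv hy hz ha hb hab
      simpa [← add_mul, hab] using this
    exact hc.ordConnected.out (hfmem x hx2) (h1 x hx2) hy
  · exact fun x _ y hxy => hfle x y hxy
  · exact fun x hx y hy => hF x hx y (hmem2 y hy)
  · intro x hx
    have e1 := hF x hx (x + 1) ⟨by linarith [hx.1], by linarith [hx.2]⟩
    have e2 := hF x hx (x - 1) ⟨by linarith [hx.1], by linarith [hx.2]⟩
    have e3 := hfle (x + 1) 1 (h1 _ ⟨by linarith [hx.1], by linarith [hx.2]⟩)
    have e4 := hfle (x - 1) 1 (h1 _ ⟨by linarith [hx.1], by linarith [hx.2]⟩)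
    have e5 := (abs_le.1 (hH' _ _ (hfmem x (hmem2 x hx)))).1
    exact abs_le.2 ⟨by linarith, by linarith⟩
  · intro x hx
    rcases le_total 0 x with h | h
    · have := hconv (h1 2 (by norm_num)) h0 (a := x / 2) (b := 1 - x / 2) (by linarith)
        (by linarith [hx.2]) (by ring)
      have h2 := hfle x (x / 2) (by simpa using this)
      linarith [hx.2]
    · have := hconv (h1 (-2) (by norm_num)) h0 (a := -x / 2) (b := 1 - -x / 2) (by linarith)
        (by linarith [hx.1]) (by ring)
      have h2 := hfle x (-x / 2) (by simpa using this)
      linarith [hx.1]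

theorem exists_equiv_of_ne_zero {v : E2} (hv : v ≠ 0) {τ : ℝ} (hτ : τ ≠ 0) :
    ∃ φ : (ℝ × ℝ) ≃L[ℝ] E2, ∀ w y, φ (w, y) = (w * τ) • !₂[-v 1, v 0] + y • v := by
  have hN : v 0 ^ 2 + v 1 ^ 2 ≠ 0 := by
    intro h
    apply hv
    ext i
    fin_cases i
    · simpa using (by nlinarith [sq_nonneg (v 0), sq_nonneg (v 1)] : v 0 ^ 2 = 0)
    · simpa using (by nlinarith [sq_nonneg (v 0), sq_nonneg (v 1)] : v 1 ^ 2 = 0)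
  let φ : (ℝ × ℝ) ≃ₗ[ℝ] E2 :=
    { toFun := fun q => (q.1 * τ) • !₂[-v 1, v 0] + q.2 • v
      map_add' := fun q r => by
        simp only [Prod.fst_add, Prod.snd_add]
        module
      map_smul' := fun s q => by
        simp only [Prod.smul_fst, Prod.smul_snd, smul_eq_mul, RingHom.id_apply]
        module
      invFun := fun x => ((v 0 * x 1 - v 1 * x 0) / (τ * (v 0 ^ 2 + v 1 ^ 2)),
        (v 0 * x 0 + v 1 * x 1) / (v 0 ^ 2 + v 1 ^ 2))
      left_inv := fun q => by
        ext
        · simp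
          field_simp
          ring
        · simp
          field_simp
          ring
      right_inv := fun x => by
        ext i
        fin_cases i
        · simp
          field_simp
          ring
        · simp
          field_simp
          ring }
  exact ⟨φ.toContinuousLinearEquiv, fun w y => rfl⟩

/-- `S ∩ D` is controlled by finite subsets of `D` of size `O(ε⁻²)` at resolution `ε`. -/
def HasMeshes (D S : Set E2) : Prop :=
  ∃ C : ℝ, 0 ≤ C ∧ ∀ ε : ℝ, 0 < ε → ε ≤ 1 → ∃ Y : Finset E2,
    ↑Y ⊆ D ∧ (Y.card : ℝ) ≤ C / ε ^ 2 ∧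
    ∀ x ∈ S, x ∈ D → ∃ q ∈ Y,
      ∀ L : ℝ, 0 ≤ L → ∀ P, QuadLip D L P → |P x - P q| ≤ L * (6 * ε)

theorem IsConvexBody.exists_hasMeshes {D : Set E2} (hD : IsConvexBody D) {z : E2} (hz : z ∈ D) :
    ∃ U : Set E2, IsOpen U ∧ z ∈ U ∧ HasMeshes D U := by
  obtain ⟨hconv, hcomp, hint⟩ := hD
  have := Module.punctured_nhds_neBot ℝ E2 z
  obtain ⟨c, hc, hcz⟩ := (dense_compl_singleton z).inter_open_nonempty _ isOpen_interior hint
  have hv : c - z ≠ 0 := sub_ne_zero.2 hcz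
  set v := c - z with hvdef
  have hnear : ∀ᶠ s : ℝ in nhds 0, c + s • !₂[-v 1, v 0] ∈ interior D := by
    have hcont : Continuous fun s : ℝ => c + s • !₂[-v 1, v 0] := by fun_prop
    exact hcont.continuousAt.eventually_mem (isOpen_interior.mem_nhds (by simpa using hc))
  obtain ⟨δ, hδ, hδD⟩ := Metric.eventually_nhds_iff.1 hnear
  obtain ⟨φ, hφ⟩ := exists_equiv_of_ne_zero hv (τ := δ / 4) (by positivity)
  have hcont : Continuous fun q : ℝ × ℝ => z + φ q := by fun_prop
  obtain ⟨f, F, Λ, hΛ, hchart⟩ := exists_isLowerChart (D := (fun q => z + φ q) ⁻¹' D)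
    (by
      intro q hq r hr a b ha hb hab
      have h1 := hconv hq hr ha hb hab
      have h2 : a • (z + φ q) + b • (z + φ r) = z + φ (a • q + b • r) := by
        rw [map_add, map_smul, map_smul]
        calc a • (z + φ q) + b • (z + φ r) = (a + b) • z + (a • φ q + b • φ r) := by module
          _ = _ := by rw [hab, one_smul]
      simpa only [mem_preimage, h2] using h1)
    (by
      have h1 : (fun q => z + φ q) ⁻¹' D = (fun x => φ.symm (x - z)) '' D := by
        ext q
        constructor
        · intro hq
          exact ⟨_, hq, by simp⟩
        · rintro ⟨x, hx, rfl⟩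
          simpa using hx
      rw [h1]
      exact hcomp.image (by fun_prop))
    (by simpa [hφ] using hz)
    (by
      intro w hw
      have h1 : z + φ (w, 1) = c + (w * (δ / 4)) • !₂[-v 1, v 0] := by
        rw [hφ, hvdef]
        module
      rw [mem_preimage, h1]
      refine interior_subset (hδD ?_)
      rw [Real.dist_eq, sub_zero, abs_lt]
      constructor <;> nlinarith [hw.1, hw.2])
  obtain ⟨C, hC, hmesh⟩ := hchart.exists_mesh hΛ
  have hsymm : Continuous fun x => φ.symm (x - z) := by fun_prop
  refine ⟨{x | |(φ.symm (x - z)).1| < 1 / 2 ∧ (φ.symm (x - z)).2 < 1 / 4}, ?_, by simp, C, hC,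
    fun ε hε hε1 => ?_⟩
  · exact (isOpen_lt hsymm.fst.abs continuous_const).inter (isOpen_lt hsymm.snd continuous_const)
  · obtain ⟨Y, hYD, hYcard, hY⟩ := hmesh ε hε hε1
    classical
    refine ⟨Y.image fun q => z + φ q, ?_, ?_, ?_⟩
    · rw [Finset.coe_image, image_subset_iff]
      exact hYD
    · exact (Nat.cast_le.2 Finset.card_image_le).trans hYcard
    · rintro x ⟨hx1, hx2⟩ hxD
      have hx : z + φ (φ.symm (x - z)) = x := by simp
      obtain ⟨q, hq, hP⟩ := hY (φ.symm (x - z)).1 (φ.symm (x - z)).2 hx1.le hx2.le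
        (by rwa [Prod.mk.eta, mem_preimage, hx])
      refine ⟨_, Finset.mem_image_of_mem _ hq, fun L hL P hLip => ?_⟩
      have h1 : |P (z + φ (φ.symm (x - z))) - P (z + φ q)| ≤ L * (6 * ε) :=
        hP L hL _ (hLip.comp_affine z φ.toLinearMap)
      rwa [hx] at h1

theorem IsConvexBody.hasMeshes {D : Set E2} (hD : IsConvexBody D) : HasMeshes D D := by
  classical
  refine hD.2.1.induction_on (p := HasMeshes D) ?_ ?_ ?_ ?_
  · exact ⟨0, le_rfl, fun ε _ _ => ⟨∅, by simp, by simp, fun x hx => absurd hx (notMem_empty x)⟩⟩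
  · rintro S T hST ⟨C, hC, h⟩
    refine ⟨C, hC, fun ε hε hε1 => ?_⟩
    obtain ⟨Y, h1, h2, h3⟩ := h ε hε hε1
    exact ⟨Y, h1, h2, fun x hx => h3 x (hST hx)⟩
  · rintro S T ⟨C, hC, h⟩ ⟨C', hC', h'⟩
    refine ⟨C + C', by positivity, fun ε hε hε1 => ?_⟩
    obtain ⟨Y, h1, h2, h3⟩ := h ε hε hε1
    obtain ⟨Y', h1', h2', h3'⟩ := h' ε hε hε1
    refine ⟨Y ∪ Y', by simp [h1, h1'], ?_, ?_⟩
    · have h4 : ((Y ∪ Y').card : ℝ) ≤ Y.card + Y'.card := by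
        exact_mod_cast Finset.card_union_le Y Y'
      rw [add_div]
      linarith
    · rintro x (hx | hx) hxD
      · obtain ⟨q, hq, hP⟩ := h3 x hx hxD
        exact ⟨q, Finset.mem_union_left _ hq, hP⟩
      · obtain ⟨q, hq, hP⟩ := h3' x hx hxD
        exact ⟨q, Finset.mem_union_right _ hq, hP⟩
  · intro z hz
    obtain ⟨U, hU, hzU, h⟩ := hD.exists_hasMeshes hz
    exact ⟨U, mem_nhdsWithin_of_mem_nhds (hU.mem_nhds hzU), h⟩

/-- Every planar convex body possesses optimal polynomial meshes. -/
theorem stmt8 (D : Set E2) (hD : IsConvexBody D) :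
    ∃ μ ν : ℝ, 0 < μ ∧ 0 < ν ∧ ∀ n : ℕ, 1 ≤ n → ∃ Y : Finset E2,
      ↑Y ⊆ D ∧ (Y.card : ℝ) ≤ μ * (n : ℝ) ^ 2 ∧
      ∀ p : MvPolynomial (Fin 2) ℝ, p.totalDegree ≤ n → ∀ z ∈ D,
        |MvPolynomial.eval (fun i => z i) p| ≤
          ν * sSup ((fun y : E2 => |MvPolynomial.eval (fun i => y i) p|) '' ↑Y) := by
  obtain ⟨C, hC, hmesh⟩ := hD.hasMeshes
  refine ⟨C * 168 ^ 2 + 1, 2, by positivity, by norm_num, fun n hn => ?_⟩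
  have hn1 : (1 : ℝ) ≤ n := by exact_mod_cast hn
  obtain ⟨Y, hYD, hYcard, hY⟩ := hmesh (1 / (168 * n)) (by positivity) (by
    rw [div_le_one (by positivity)]
    linarith)
  refine ⟨Y, hYD, ?_, fun p hp z hz => ?_⟩
  · have h1 : C / (1 / (168 * (n : ℝ))) ^ 2 = C * 168 ^ 2 * (n : ℝ) ^ 2 := by
      field_simp
    rw [h1] at hYcard
    nlinarith [sq_nonneg (n : ℝ)]
  · have hpc : Continuous fun y : E2 => |MvPolynomial.eval (fun i => y i) p| :=
      (p.continuous_eval.comp (by fun_prop)).abs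
    obtain ⟨z₀, hz₀, hmax⟩ := hD.2.1.exists_isMaxOn ⟨z, hz⟩ hpc.continuousOn
    obtain ⟨q, hq, hP⟩ := hY z₀ hz₀ hz₀
    set M := |MvPolynomial.eval (fun i => z₀ i) p| with hM
    have h1 := hP (14 * n * M) (by positivity) _
      (quadLip_mvPolynomial_eval D n p hp M fun y hy => hmax hy)
    have h2 : 14 * n * M * (6 * (1 / (168 * (n : ℝ)))) = M / 2 := by
      field_simp
      ring
    have h3 := abs_sub_abs_le_abs_sub (MvPolynomial.eval (fun i => z₀ i) p)
      (MvPolynomial.eval (fun i => q i) p)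
    have h4 : |MvPolynomial.eval (fun i => q i) p| ≤
        sSup ((fun y : E2 => |MvPolynomial.eval (fun i => y i) p|) '' ↑Y) :=
      le_csSup (Y.finite_toSet.image _).bddAbove ⟨q, hq, rfl⟩
    have h5 : |MvPolynomial.eval (fun i => z i) p| ≤ M := hmax hz
    linarith
end
end

section
/- For every convex body D ⊆ ℝ² and every ε > 0 there exists a constant μ > 0 (depending on D and ε) such that for every integer n ≥ 1 there is a finite set Yₙ ⊆ D of cardinality at most μ·n² with max_{y∈D} |p(y)| ≤ (1+ε) · max_{y∈Yₙ} |p(y)| for every real polynomial p in two variables of total degree ≤ n. -/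
open MeasureTheory Set Pointwise

noncomputable section

/-- Growth of a polynomial bounded on `[-1, 1]`, along the complex cosine, in the closed upper
half plane. -/
lemma norm_aeval_cos_le_of_im_nonneg {q : Polynomial ℝ} {d : ℕ} (hd : q.natDegree ≤ d)
    (hq : ∀ x ∈ Icc (-1 : ℝ) 1, |q.eval x| ≤ 1) {w : ℂ} (hw : 0 ≤ w.im) :
    ‖Polynomial.aeval (Complex.cos w) q‖ ≤ Real.exp (d * w.im) := by
  set F : ℂ → ℂ := fun z =>
    ∑ k ∈ Finset.range (d + 1), (q.coeff k : ℂ) * (z ^ (d - k) * ((z ^ 2 + 1) / 2) ^ k) with hF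
  have key : ∀ v : ℂ, F (Complex.exp (v * Complex.I)) =
      Complex.exp (v * Complex.I) ^ d * Polynomial.aeval (Complex.cos v) q := by
    intro v
    rw [Polynomial.aeval_eq_sum_range' (Nat.lt_succ_of_le hd), hF, Finset.mul_sum]
    refine Finset.sum_congr rfl fun k hk => ?_
    have hk' : k ≤ d := Nat.lt_succ_iff.mp (Finset.mem_range.mp hk)
    have hcos : (Complex.exp (v * Complex.I) ^ 2 + 1) / 2 =
        Complex.exp (v * Complex.I) * Complex.cos v := by
      rw [Complex.cos, neg_mul, Complex.exp_neg]
      have := Complex.exp_ne_zero (v * Complex.I)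
      field_simp
    rw [hcos, mul_pow, ← mul_assoc (_ ^ (d - k)), ← pow_add, Nat.sub_add_cancel hk',
      Complex.real_smul]
    ring
  have hdiff : Differentiable ℂ F := by
    rw [hF]; fun_prop
  have hfr : ∀ z ∈ frontier (Metric.ball (0 : ℂ) 1), ‖F z‖ ≤ 1 := by
    intro z hz
    rw [frontier_ball _ one_ne_zero, mem_sphere_zero_iff_norm] at hz
    have hz' : z = Complex.exp ((Complex.arg z : ℂ) * Complex.I) := by
      conv_lhs => rw [← Complex.norm_mul_exp_arg_mul_I z, hz]
      simp
    rw [hz', key, norm_mul, norm_pow, Complex.norm_exp_ofReal_mul_I, one_pow, one_mul,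
      ← Complex.ofReal_cos]
    have h2 := Polynomial.aeval_algebraMap_apply ℂ (Real.cos (Complex.arg z)) q
    rw [Complex.coe_algebraMap] at h2
    rw [h2, Complex.norm_real, Real.norm_eq_abs, Polynomial.coe_aeval_eq_eval]
    exact hq _ (Real.cos_mem_Icc _)
  have hnorm : ‖Complex.exp (w * Complex.I)‖ = Real.exp (-w.im) := by
    rw [Complex.norm_exp]; simp
  have hle := Complex.norm_le_of_forall_mem_frontier_norm_le Metric.isBounded_ball
    hdiff.diffContOnCl hfr (z := Complex.exp (w * Complex.I)) (by
      rw [closure_ball _ one_ne_zero, mem_closedBall_zero_iff, hnorm]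
      exact Real.exp_le_one_iff.mpr (by linarith))
  rw [key, norm_mul, norm_pow, hnorm, ← Real.exp_nat_mul, mul_neg, Real.exp_neg] at hle
  have hpos := Real.exp_pos (d * w.im)
  rwa [inv_mul_le_iff₀ hpos, mul_one] at hle

lemma norm_aeval_cos_le {q : Polynomial ℝ} {d : ℕ} (hd : q.natDegree ≤ d)
    (hq : ∀ x ∈ Icc (-1 : ℝ) 1, |q.eval x| ≤ 1) (w : ℂ) :
    ‖Polynomial.aeval (Complex.cos w) q‖ ≤ Real.exp (d * |w.im|) := by
  rcases le_total 0 w.im with h | h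
  · rw [abs_of_nonneg h]
    exact norm_aeval_cos_le_of_im_nonneg hd hq h
  · rw [abs_of_nonpos h, ← Complex.cos_neg w, ← Complex.neg_im]
    exact norm_aeval_cos_le_of_im_nonneg hd hq (by simpa using h)

/-- A Bernstein inequality: a polynomial of degree at most `d` bounded by `1` on `[-1, 1]` is
`3d`-Lipschitz in the angular variable. -/
lemma abs_eval_sub_eval_le_arccos {q : Polynomial ℝ} {d : ℕ} (hd : q.natDegree ≤ d) (hd1 : 1 ≤ d)
    (hq : ∀ x ∈ Icc (-1 : ℝ) 1, |q.eval x| ≤ 1) {u v : ℝ} (hu : u ∈ Icc (-1 : ℝ) 1)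
    (hv : v ∈ Icc (-1 : ℝ) 1) :
    |q.eval u - q.eval v| ≤ 3 * d * |Real.arccos u - Real.arccos v| := by
  set G : ℂ → ℂ := fun w => Polynomial.aeval (Complex.cos w) q with hG
  have hdiff : Differentiable ℂ G := by
    rw [hG]
    exact (Polynomial.differentiable_aeval q).comp Complex.differentiable_cos
  have hd0 : (0 : ℝ) < d := by exact_mod_cast hd1
  have hder : ∀ θ : ℝ, ‖deriv G θ‖ ≤ 3 * d := by
    intro θ
    have h := Complex.norm_deriv_le_of_forall_mem_sphere_norm_le (c := (θ : ℂ)) (R := 1 / (d : ℝ))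
      (C := Real.exp 1) (f := G) (by positivity) hdiff.diffContOnCl (by
        intro z hz
        refine (norm_aeval_cos_le hd hq z).trans (Real.exp_le_exp.mpr ?_)
        have h1 : |z.im| ≤ 1 / d := by
          have := Complex.abs_im_le_norm (z - θ)
          rw [mem_sphere_iff_norm] at hz
          simpa [hz] using this
        calc (d : ℝ) * |z.im| ≤ d * (1 / d) := by gcongr
          _ = 1 := by field_simp)
    refine h.trans ?_
    rw [div_div_eq_mul_div, div_one]
    have := Real.exp_one_lt_d9
    gcongr
    linarith
  have hreal : ∀ x ∈ Icc (-1 : ℝ) 1, G (Real.arccos x) = (q.eval x : ℝ) := by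
    intro x hx
    have h2 := Polynomial.aeval_algebraMap_apply ℂ x q
    rw [Complex.coe_algebraMap, Polynomial.coe_aeval_eq_eval] at h2
    rw [hG]
    simp only [← Complex.ofReal_cos, Real.cos_arccos hx.1 hx.2, h2]
  have hmv := convex_univ.norm_image_sub_le_of_norm_hasDerivWithin_le
    (f := fun θ : ℝ => G θ) (f' := fun θ : ℝ => deriv G θ) (C := 3 * d)
    (fun θ _ => ((hdiff θ).hasDerivAt.comp_ofReal).hasDerivWithinAt)
    (fun θ _ => hder θ) (mem_univ (Real.arccos v)) (mem_univ (Real.arccos u))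
  rw [hreal u hu, hreal v hv, ← Complex.ofReal_sub, Complex.norm_real] at hmv
  exact hmv

lemma abs_arccos_sub_arccos_zero_le {u : ℝ} (hu : u ∈ Icc (-1 : ℝ) 1) :
    |Real.arccos u - Real.arccos 0| ≤ 2 * |u| := by
  have h := Real.mul_abs_le_abs_sin (x := Real.arcsin u)
    (abs_le.mpr ⟨Real.neg_pi_div_two_le_arcsin u, Real.arcsin_le_pi_div_two u⟩)
  rw [Real.sin_arcsin hu.1 hu.2] at h
  have hpi := Real.pi_pos
  have hpi4 := Real.pi_le_four
  rw [Real.arccos, Real.arccos_zero, sub_sub_cancel_left, abs_neg]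
  rw [div_mul_eq_mul_div, div_le_iff₀ hpi] at h
  nlinarith [abs_nonneg u, abs_nonneg (Real.arcsin u)]

lemma arccos_one_sub_le {τ v : ℝ} (h0 : 0 ≤ τ) (h2 : τ ≤ 2) (hv : 0 ≤ v) (hτ : τ ≤ v ^ 2) :
    Real.arccos (1 - τ) ≤ 4 * v := by
  have h := Real.cos_le_one_sub_mul_cos_sq (x := Real.arccos (1 - τ))
    (by rw [abs_of_nonneg (Real.arccos_nonneg _)]; exact Real.arccos_le_pi _)
  rw [Real.cos_arccos (by linarith) (by linarith)] at h
  have hpi := Real.pi_pos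
  have hpi4 := Real.pi_le_four
  refine abs_le_of_sq_le_sq' ?_ (by positivity) |>.2
  have h3 : 2 / Real.pi ^ 2 * Real.arccos (1 - τ) ^ 2 ≤ τ := by linarith
  rw [div_mul_eq_mul_div, div_le_iff₀ (by positivity)] at h3
  nlinarith [mul_le_mul_of_nonneg_left (show Real.pi ^ 2 ≤ 16 by nlinarith) h0]

/-- `x` is a point where the graph of `g` over `[-2, 2]` is touched from below by a parabola of
opening `l` whose vertex has abscissa `y`. -/
def IsContact (g : ℝ → ℝ) (l x y : ℝ) : Prop :=
  |x| ≤ 5 / 4 ∧ ∀ t ∈ Icc (-2 : ℝ) 2,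
    g x + 2 * l * (y - x) * (t - x) - l * (t - x) ^ 2 ≤ g t ∧
      g t ≤ g x + 2 * l * (y - x) * (t - x)

lemma ConcaveOn.le_of_parabola_le {g : ℝ → ℝ} (hg : ConcaveOn ℝ (Icc (-2) 2) g) {x m l : ℝ}
    (hx : |x| ≤ 5 / 4) (h : ∀ t ∈ Icc (-2 : ℝ) 2, g x + m * (t - x) - l * (t - x) ^ 2 ≤ g t)
    {t : ℝ} (ht : t ∈ Icc (-2 : ℝ) 2) : g t ≤ g x + m * (t - x) := by
  have hx' := abs_le.mp hx
  refine le_of_forall_pos_le_add fun e he => ?_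
  obtain ⟨τ, hτ0, hτ1, hτ2⟩ : ∃ τ : ℝ, 0 < τ ∧ τ ≤ 1 / 8 ∧ τ * (|l| * 16) ≤ e := by
    refine ⟨min (1 / 8) (e / (|l| * 16 + 1)), by positivity, min_le_left _ _, ?_⟩
    calc min (1 / 8) (e / (|l| * 16 + 1)) * (|l| * 16)
        ≤ e / (|l| * 16 + 1) * (|l| * 16) := by gcongr; exact min_le_right _ _
      _ ≤ e := by
        rw [div_mul_eq_mul_div, div_le_iff₀ (by positivity)]
        nlinarith
  have hs : x - τ * (t - x) ∈ Icc (-2 : ℝ) 2 := by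
    constructor <;> nlinarith [ht.1, ht.2, hx'.1, hx'.2]
  have h1 := hg.2 ht hs (show 0 ≤ τ / (1 + τ) by positivity) (show 0 ≤ 1 / (1 + τ) by positivity)
    (by field_simp; ring)
  have h2 : (τ / (1 + τ)) • t + (1 / (1 + τ)) • (x - τ * (t - x)) = x := by
    simp only [smul_eq_mul]; field_simp; ring
  rw [h2, smul_eq_mul, smul_eq_mul] at h1
  have h3 : τ * g t + g (x - τ * (t - x)) ≤ (1 + τ) * g x := by
    have : τ / (1 + τ) * g t + 1 / (1 + τ) * g (x - τ * (t - x)) =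
        (τ * g t + g (x - τ * (t - x))) / (1 + τ) := by field_simp
    rw [this, div_le_iff₀ (by positivity)] at h1
    linarith
  have h4 := h _ hs
  have h5 : l * (t - x) ^ 2 ≤ |l| * 16 :=
    mul_le_mul (le_abs_self l) (by nlinarith [ht.1, ht.2, hx'.1, hx'.2]) (sq_nonneg _)
      (abs_nonneg l)
  have h6 : τ * g t ≤ τ * (g x + m * (t - x) + e) := by
    have : τ * (τ * (l * (t - x) ^ 2)) ≤ τ * e :=
      mul_le_mul_of_nonneg_left ((mul_le_mul_of_nonneg_left h5 hτ0.le).trans hτ2) hτ0.le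
    linarith
  exact le_of_mul_le_mul_left h6 hτ0

lemma IsContact.abs_slope_le {g : ℝ → ℝ} {M l x y : ℝ} (h : IsContact g l x y)
    (h0 : ∀ t ∈ Icc (-2 : ℝ) 2, 0 ≤ g t) (hM : ∀ t ∈ Icc (-2 : ℝ) 2, g t ≤ M) :
    |2 * l * (y - x)| ≤ 2 * M := by
  have hx := abs_le.mp h.1
  have hx2 : x ∈ Icc (-2 : ℝ) 2 := ⟨by linarith, by linarith⟩
  have h1 := (h.2 2 ⟨by norm_num, le_rfl⟩).2
  have h2 := (h.2 (-2) ⟨le_rfl, by norm_num⟩).2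
  have h3 := h0 2 ⟨by norm_num, le_rfl⟩
  have h4 := h0 (-2) ⟨le_rfl, by norm_num⟩
  have h5 := hM x hx2
  have h6 := h0 x hx2
  rw [abs_le]
  constructor <;> nlinarith

lemma exists_isContact {g : ℝ → ℝ} (hg : ConcaveOn ℝ (Icc (-2) 2) g)
    (hc : ContinuousOn g (Icc (-2) 2)) {M l y : ℝ} (hM0 : 0 < M)
    (h0 : ∀ t ∈ Icc (-2 : ℝ) 2, 0 ≤ g t) (hM : ∀ t ∈ Icc (-2 : ℝ) 2, g t ≤ M)
    (hl : 16 * M ≤ l) (hy : y ∈ Icc (-1 : ℝ) 1) :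
    ∃ x, IsContact g l x y ∧ |x - y| ≤ M / l := by
  have hy2 : y ∈ Icc (-2 : ℝ) 2 := ⟨by linarith [hy.1], by linarith [hy.2]⟩
  obtain ⟨x, hx, hmin⟩ := isCompact_Icc.exists_isMinOn ⟨y, hy2⟩
    (f := fun t => g t + l * (t - y) ^ 2) (hc.add (by fun_prop))
  have hmin' : ∀ t ∈ Icc (-2 : ℝ) 2, g x + l * (x - y) ^ 2 ≤ g t + l * (t - y) ^ 2 :=
    fun t ht => hmin ht
  have hl0 : 0 < l := by linarith
  have hxy : |x - y| ≤ 1 / 4 := by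
    have h1 := hmin' y hy2
    have h2 := h0 x hx
    have h3 := hM y hy2
    refine abs_le_of_sq_le_sq ?_ (by norm_num)
    nlinarith [sq_nonneg (x - y)]
  have hx54 : |x| ≤ 5 / 4 := by
    have := abs_le.mp hxy
    exact abs_le.mpr ⟨by linarith [hy.1], by linarith [hy.2]⟩
  have hlow : ∀ t ∈ Icc (-2 : ℝ) 2,
      g x + 2 * l * (y - x) * (t - x) - l * (t - x) ^ 2 ≤ g t := by
    intro t ht
    have := hmin' t ht
    nlinarith
  have hcon : IsContact g l x y :=
    ⟨hx54, fun t ht => ⟨hlow t ht, hg.le_of_parabola_le hx54 hlow ht⟩⟩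
  refine ⟨x, hcon, ?_⟩
  have := hcon.abs_slope_le h0 hM
  rw [abs_mul, abs_of_pos (by linarith : 0 < 2 * l), abs_sub_comm] at this
  rw [le_div_iff₀ hl0]
  linarith

/-- Contact points are at least as far apart as the vertices of the touching parabolas. -/
lemma IsContact.sub_le_sub {g : ℝ → ℝ} {l x y x' y' : ℝ} (hl : 0 < l) (h : IsContact g l x y)
    (h' : IsContact g l x' y') (hy : y < y') (hyy : y' - y ≤ 2) : y' - y ≤ x' - x := by
  have hx := abs_le.mp h.1
  have hx' := abs_le.mp h'.1
  have hx2 : x ∈ Icc (-2 : ℝ) 2 := ⟨by linarith, by linarith⟩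
  have hx2' : x' ∈ Icc (-2 : ℝ) 2 := ⟨by linarith, by linarith⟩
  obtain ⟨h1, h2⟩ := h.2 x' hx2'
  obtain ⟨h3, h4⟩ := h'.2 x hx2
  have hle : x ≤ x' := by
    by_contra! hlt
    nlinarith [mul_pos hl (mul_pos (sub_pos.mpr hlt) (sub_pos.mpr hy))]
  rcases hle.eq_or_lt with rfl | hlt
  · have ht : x + (y' - y) / 4 ∈ Icc (-2 : ℝ) 2 := ⟨by linarith, by linarith⟩
    have h5 := (h.2 _ ht).2
    have h6 := (h'.2 _ ht).1
    nlinarith [mul_pos hl (mul_pos (sub_pos.mpr hy) (sub_pos.mpr hy))]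
  · by_contra! hcon
    have : 0 < (y' - y) - (x' - x) := by linarith
    nlinarith [mul_pos hl (mul_pos this (sub_pos.mpr hlt))]

/-- `f` is `k`-Lipschitz in the angular parameter along the curves `(a₀ + a₁ u, b₀ + b₁ u + b₂ u²)`,
`u ∈ [-1, 1]`, that stay between the first axis and the graph of `g` over `[-2, 2]`. -/
def AngularLipschitz (k : ℝ) (g : ℝ → ℝ) (f : ℝ → ℝ → ℝ) : Prop :=
  ∀ a₀ a₁ b₀ b₁ b₂ : ℝ,
    (∀ u ∈ Icc (-1 : ℝ) 1, a₀ + a₁ * u ∈ Icc (-2 : ℝ) 2 ∧ 0 ≤ b₀ + b₁ * u + b₂ * u ^ 2 ∧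
      b₀ + b₁ * u + b₂ * u ^ 2 ≤ g (a₀ + a₁ * u)) →
    ∀ u ∈ Icc (-1 : ℝ) 1, ∀ v ∈ Icc (-1 : ℝ) 1,
      |f (a₀ + a₁ * u) (b₀ + b₁ * u + b₂ * u ^ 2) - f (a₀ + a₁ * v) (b₀ + b₁ * v + b₂ * v ^ 2)| ≤
        k * |Real.arccos u - Real.arccos v|

lemma AngularLipschitz.scale {k : ℝ} {g : ℝ → ℝ} {f : ℝ → ℝ → ℝ} (hf : AngularLipschitz k g f)
    {s : ℝ} (hs : s ∈ Icc (0 : ℝ) 1) : AngularLipschitz k g fun x y => f x (s * y) := by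
  intro a₀ a₁ b₀ b₁ b₂ h u hu v hv
  have := hf a₀ a₁ (s * b₀) (s * b₁) (s * b₂) (fun u hu => by
    obtain ⟨h1, h2, h3⟩ := h u hu
    have h4 : s * b₀ + s * b₁ * u + s * b₂ * u ^ 2 = s * (b₀ + b₁ * u + b₂ * u ^ 2) := by ring
    rw [h4]
    exact ⟨h1, mul_nonneg hs.1 h2, (mul_le_of_le_one_left h2 hs.2).trans h3⟩) u hu v hv
  convert this using 4 <;> ring

lemma AngularLipschitz.vertical {k : ℝ} {g : ℝ → ℝ} {f : ℝ → ℝ → ℝ}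
    (hf : AngularLipschitz k g f) (h0 : ∀ t ∈ Icc (-2 : ℝ) 2, 0 ≤ g t) {x : ℝ}
    (hx : x ∈ Icc (-2 : ℝ) 2) {u v : ℝ} (hu : u ∈ Icc (-1 : ℝ) 1) (hv : v ∈ Icc (-1 : ℝ) 1) :
    |f x ((1 + u) / 2 * g x) - f x ((1 + v) / 2 * g x)| ≤
      k * |Real.arccos u - Real.arccos v| := by
  have := hf x 0 (g x / 2) (g x / 2) 0 (fun u hu => by
    have h := h0 x hx
    rw [zero_mul, add_zero]
    exact ⟨hx, by nlinarith [hu.1], by nlinarith [hu.2]⟩) u hu v hv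
  convert this using 4 <;> ring_nf

/-- Near a contact point the values of `f` on the graph of `g` are almost constant. -/
lemma AngularLipschitz.abs_sub_le_of_isContact {k : ℝ} {g : ℝ → ℝ} {f : ℝ → ℝ → ℝ}
    (hf : AngularLipschitz k g f) (hk : 0 < k) {b M l x y a t : ℝ} (hb : 0 < b)
    (hgb : ∀ t ∈ Icc (-2 : ℝ) 2, b ≤ g t) (hM : ∀ t ∈ Icc (-2 : ℝ) 2, g t ≤ M)
    (h : IsContact g l x y) (hl : 0 < l) (ha : 0 < a) (ha2 : a ≤ 1 / 2)
    (hla : 2 * l * a ^ 2 ≤ b) (hMa : 2 * M * a ≤ b / 2) (ht : |t - x| ≤ a / (24 * k)) (hk1 : 1 ≤ k) :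
    |f t (g t) - f x (g x)| ≤ 1 / 4 := by
  have h0 : ∀ t ∈ Icc (-2 : ℝ) 2, 0 ≤ g t := fun t ht => hb.le.trans (hgb t ht)
  have hx := abs_le.mp h.1
  have hx2 : x ∈ Icc (-2 : ℝ) 2 := ⟨by linarith, by linarith⟩
  set m := 2 * l * (y - x) with hm
  have hmM : |m| ≤ 2 * M := h.abs_slope_le h0 hM
  set w := (t - x) / a with hw
  have htx : t = x + a * w := by rw [hw]; field_simp; ring
  have hw24 : |w| ≤ 1 / (24 * k) := by
    rw [hw, abs_div, abs_of_pos ha, div_le_iff₀ ha]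
    calc |t - x| ≤ a / (24 * k) := ht
      _ = _ := by ring
  have hw1 : w ∈ Icc (-1 : ℝ) 1 := by
    refine abs_le.mp (hw24.trans ?_)
    rw [div_le_one (by positivity)]
    linarith
  have hin : ∀ u ∈ Icc (-1 : ℝ) 1, x + a * u ∈ Icc (-2 : ℝ) 2 := fun u hu =>
    ⟨by nlinarith [hu.1], by nlinarith [hu.2]⟩
  have hpar0 : ∀ u ∈ Icc (-1 : ℝ) 1, 0 ≤ g x + m * a * u + (-(l * a ^ 2)) * u ^ 2 := by
    intro u hu
    have hu1 : |u| ≤ 1 := abs_le.mpr hu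
    have h1 : |m * a * u| ≤ b / 2 := by
      rw [abs_mul, abs_mul, abs_of_pos ha]
      calc |m| * a * |u| ≤ |m| * a * 1 := by gcongr
        _ ≤ 2 * M * a := by rw [mul_one]; gcongr
        _ ≤ _ := hMa
    have h2 : l * a ^ 2 * u ^ 2 ≤ l * a ^ 2 * 1 := by
      gcongr
      exact (sq_le_one_iff_abs_le_one u).mpr hu1
    have h3 := hgb x hx2
    have h4 := (abs_le.mp h1).1
    linarith
  have hparg : ∀ u ∈ Icc (-1 : ℝ) 1,
      g x + m * a * u + (-(l * a ^ 2)) * u ^ 2 ≤ g (x + a * u) := by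
    intro u hu
    have := (h.2 _ (hin u hu)).1
    rw [← hm] at this
    linarith
  have hstep1 := hf x a (g x) (m * a) (-(l * a ^ 2))
    (fun u hu => ⟨hin u hu, hpar0 u hu, hparg u hu⟩) w hw1 0 ⟨by norm_num, by norm_num⟩
  rw [← htx] at hstep1
  simp only [mul_zero, add_zero, ne_eq, OfNat.ofNat_ne_zero, not_false_eq_true, zero_pow] at hstep1
  set q := g x + m * a * w + (-(l * a ^ 2)) * w ^ 2 with hq
  have ht2 : t ∈ Icc (-2 : ℝ) 2 := htx ▸ hin w hw1
  have hgt := hgb t ht2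
  have hgt0 : 0 < g t := hb.trans_le hgt
  have hq0 : 0 ≤ q := hpar0 w hw1
  have hqg : q ≤ g t := by have := hparg w hw1; rwa [← htx] at this
  set τ := 2 * (g t - q) / g t with hτ
  have hτ0 : 0 ≤ τ := div_nonneg (by linarith) hgt0.le
  have hτ2 : τ ≤ 2 := by rw [hτ, div_le_iff₀ hgt0]; linarith
  have hτw : τ ≤ |w| ^ 2 := by
    rw [hτ, div_le_iff₀ hgt0, sq_abs]
    have h1 := (h.2 t ht2).2
    have h2 : g t - q ≤ l * a ^ 2 * w ^ 2 := by
      rw [hq]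
      rw [← hm] at h1
      have : t - x = a * w := by linarith
      rw [this] at h1
      linarith
    nlinarith [sq_nonneg w]
  have hstep2 := hf.vertical h0 ht2 (u := 1) (v := 1 - τ) ⟨by norm_num, le_rfl⟩
    ⟨by linarith, by linarith⟩
  have h3 : (1 + (1 - τ)) / 2 * g t = q := by rw [hτ]; field_simp; ring
  have h4 : ((1 : ℝ) + 1) / 2 * g t = g t := by ring
  rw [h3, h4, Real.arccos_one, zero_sub, abs_neg, abs_of_nonneg (Real.arccos_nonneg _)] at hstep2
  have h5 := arccos_one_sub_le hτ0 hτ2 (abs_nonneg w) hτw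
  have h6 := abs_arccos_sub_arccos_zero_le hw1
  have h7 : k * |w| ≤ 1 / 24 := by
    calc k * |w| ≤ k * (1 / (24 * k)) := by gcongr
      _ = 1 / 24 := by field_simp
  calc |f t (g t) - f x (g x)| ≤ |f t (g t) - f t q| + |f t q - f x (g x)| := abs_sub_le _ _ _
    _ ≤ k * (4 * |w|) + k * (2 * |w|) := by
      gcongr
      · exact hstep2.trans (by gcongr)
      · exact hstep1.trans (by gcongr)
    _ ≤ 1 / 4 := by linarith

/-- At scale `1 / (N 2ʲ)`, all but few of the cells of `[-1, 1)` contain contact points. -/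
lemma card_cells_without_contact_le {g : ℝ → ℝ} (hg : ConcaveOn ℝ (Icc (-2) 2) g)
    (hc : ContinuousOn g (Icc (-2) 2)) {M : ℝ} (hM0 : 0 < M)
    (h0 : ∀ t ∈ Icc (-2 : ℝ) 2, 0 ≤ g t) (hM : ∀ t ∈ Icc (-2 : ℝ) 2, g t ≤ M)
    (N : ℕ) (hN : 1 ≤ N) (j : ℕ) {S : Finset ℤ} (hS : S ⊆ Finset.Ico (-(N * 2 ^ j : ℤ)) (N * 2 ^ j))
    (hbad : ∀ i ∈ S, ∀ x y, IsContact g (16 * M * 4 ^ j) x y → ⌊x * (N * 2 ^ j)⌋ ≠ i) :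
    (S.card : ℝ) ≤ N * (1 / 2) ^ j + 2 := by
  set H : ℝ := N * 2 ^ j with hH
  have hN' : (1 : ℝ) ≤ N := by exact_mod_cast hN
  have hH0 : 0 < H := by positivity
  set l : ℝ := 16 * M * 4 ^ j with hl
  have h4 : (1 : ℝ) ≤ 4 ^ j := one_le_pow₀ (by norm_num)
  have hl16 : 16 * M ≤ l := by rw [hl]; nlinarith
  have hl0 : 0 < l := by positivity
  set R : ℤ := ⌈(N : ℝ) * (1 / 2) ^ j / 16⌉ with hR
  have hR0 : 0 ≤ R := Int.ceil_nonneg (by positivity)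
  have hMl : M / l * H = N * (1 / 2) ^ j / 16 := by
    rw [hl, hH, div_pow, one_pow, show (4 : ℝ) = 2 * 2 by norm_num, mul_pow]
    field_simp
  have hMlR : M / l * H ≤ R := hMl ▸ Int.le_ceil _
  set n : ℤ := N * 2 ^ j with hn
  have hnH : (n : ℝ) = H := by rw [hn, hH]; push_cast; ring
  have hex : ∀ r ∈ Finset.Ico (-(n - R)) (n - R), ∃ x,
      IsContact g l x (r / H) ∧ |x - r / H| ≤ M / l := by
    intro r hr
    rw [Finset.mem_Ico] at hr
    refine exists_isContact hg hc hM0 h0 hM hl16 ⟨?_, ?_⟩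
    · rw [le_div_iff₀ hH0, ← hnH]
      have : -n ≤ r := by omega
      have : (-n : ℝ) ≤ r := by exact_mod_cast this
      linarith
    · rw [div_le_iff₀ hH0, ← hnH]
      have : r ≤ n := by omega
      have : (r : ℝ) ≤ n := by exact_mod_cast this
      linarith
  choose! X hX hXr using hex
  have hmaps : ∀ r ∈ Finset.Ico (-(n - R)) (n - R),
      ⌊X r * H⌋ ∈ Finset.Ico (-n) n \ S := by
    intro r hr
    have h1 := abs_le.mp (hXr r hr)
    have h2 : |X r * H - r| ≤ R := by
      have : X r * H - r = (X r - r / H) * H := by field_simp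
      rw [this, abs_mul, abs_of_pos hH0]
      exact (mul_le_mul_of_nonneg_right (hXr r hr) hH0.le).trans hMlR
    have h3 := abs_le.mp h2
    rw [Finset.mem_Ico] at hr
    rw [Finset.mem_sdiff, Finset.mem_Ico]
    refine ⟨⟨?_, ?_⟩, fun hmem => hbad _ hmem _ _ (hX r (Finset.mem_Ico.mpr hr)) rfl⟩
    · rw [Int.le_floor]
      have : -n ≤ r - R := by omega
      have : ((-n : ℤ) : ℝ) ≤ r - R := by exact_mod_cast this
      linarith
    · rw [Int.floor_lt]
      have : r + R + 1 ≤ n := by omega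
      have : (r : ℝ) + R + 1 ≤ n := by exact_mod_cast this
      linarith
  have hinj : Set.InjOn (fun r => ⌊X r * H⌋) (Finset.Ico (-(n - R)) (n - R) : Finset ℤ) := by
    have hlt : ∀ r ∈ Finset.Ico (-(n - R)) (n - R), ∀ s ∈ Finset.Ico (-(n - R)) (n - R),
        r < s → ⌊X r * H⌋ < ⌊X s * H⌋ := by
      intro r hr s hs hrs
      have h1 : (r : ℝ) + 1 ≤ s := by exact_mod_cast hrs
      have h2 : (s : ℝ) / H - r / H ≤ 2 := by
        rw [← sub_div, div_le_iff₀ hH0, ← hnH]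
        rw [Finset.mem_Ico] at hr hs
        have : s - r ≤ 2 * n := by omega
        exact_mod_cast this
      have h3 := (hX r hr).sub_le_sub hl0 (hX s hs) (by gcongr) h2
      rw [← sub_div, div_le_iff₀ hH0] at h3
      have h4 : X r * H + 1 ≤ X s * H := by linarith
      have h5 := Int.floor_mono h4
      rw [Int.floor_add_one] at h5
      omega
    intro r hr s hs hrs
    simp only at hrs
    rcases lt_trichotomy r s with h | h | h
    · exact absurd hrs (hlt r hr s hs h).ne
    · exact h
    · exact absurd hrs (hlt s hs r hr h).ne'
  have hcard := Finset.card_le_card_of_injOn _ hmaps hinj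
  have hcS := Finset.card_le_card hS
  rw [Finset.card_sdiff_of_subset hS] at hcard
  rw [Int.card_Ico] at hcard hcS
  rw [Int.card_Ico] at hcard
  have hfin : (S.card : ℤ) ≤ 2 * R := by omega
  have hfin' : (S.card : ℝ) ≤ 2 * R := by exact_mod_cast hfin
  have hRlt := Int.ceil_lt_add_one ((N : ℝ) * (1 / 2) ^ j / 16)
  rw [← hR] at hRlt
  have : 0 ≤ (N : ℝ) * (1 / 2) ^ j := by positivity
  linarith

/-- At a sufficiently fine scale every cell contains contact points. -/
lemma exists_isContact_floor_eq {g : ℝ → ℝ} (hg : ConcaveOn ℝ (Icc (-2) 2) g)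
    (hc : ContinuousOn g (Icc (-2) 2)) {M : ℝ} (hM0 : 0 < M)
    (h0 : ∀ t ∈ Icc (-2 : ℝ) 2, 0 ≤ g t) (hM : ∀ t ∈ Icc (-2 : ℝ) 2, g t ≤ M)
    (N : ℕ) (hN : 1 ≤ N) {i : ℤ} (hi : i ∈ Finset.Ico (-(N * 2 ^ N : ℤ)) (N * 2 ^ N)) :
    ∃ x y, IsContact g (16 * M * 4 ^ N) x y ∧ ⌊x * (N * 2 ^ N)⌋ = i := by
  set H : ℝ := N * 2 ^ N with hH
  have hN' : (1 : ℝ) ≤ N := by exact_mod_cast hN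
  have hH0 : 0 < H := by positivity
  set l : ℝ := 16 * M * 4 ^ N with hl
  have h4 : (1 : ℝ) ≤ 4 ^ N := one_le_pow₀ (by norm_num)
  have hl16 : 16 * M ≤ l := by rw [hl]; nlinarith
  have hl0 : 0 < l := by positivity
  have hMl : M / l * H < 1 / 2 := by
    have h1 : M / l * H = N / 2 ^ N / 16 := by
      rw [hl, hH, show (4 : ℝ) = 2 * 2 by norm_num, mul_pow]
      field_simp
    have h2 : (N : ℝ) / 2 ^ N ≤ 1 := by
      rw [div_le_one (by positivity)]
      exact_mod_cast Nat.lt_two_pow_self.le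
    rw [h1]; linarith
  rw [Finset.mem_Ico] at hi
  have hi1 : (-H : ℝ) ≤ i := by rw [hH]; exact_mod_cast hi.1
  have hi2 : (i : ℝ) + 1 ≤ H := by rw [hH]; exact_mod_cast hi.2
  obtain ⟨x, hx, hxy⟩ := exists_isContact hg hc hM0 h0 hM hl16 (y := (i + 1 / 2) / H)
    ⟨by rw [le_div_iff₀ hH0]; linarith, by rw [div_le_iff₀ hH0]; linarith⟩
  refine ⟨x, _, hx, ?_⟩
  have h2 : |x * H - (i + 1 / 2)| < 1 / 2 := by
    have : x * H - (i + 1 / 2) = (x - (i + 1 / 2) / H) * H := by field_simp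
    rw [this, abs_mul, abs_of_pos hH0]
    exact (mul_le_mul_of_nonneg_right hxy hH0.le).trans_lt hMl
  have h3 := abs_lt.mp h2
  rw [Int.floor_eq_iff]
  constructor <;> linarith

/-- Linearly many contact points at varying scales suffice to approximate all abscissae. -/
lemma exists_finset_isContact {g : ℝ → ℝ} (hg : ConcaveOn ℝ (Icc (-2) 2) g)
    (hc : ContinuousOn g (Icc (-2) 2)) {M : ℝ} (hM0 : 0 < M)
    (h0 : ∀ t ∈ Icc (-2 : ℝ) 2, 0 ≤ g t) (hM : ∀ t ∈ Icc (-2 : ℝ) 2, g t ≤ M)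
    (N : ℕ) (hN : 1 ≤ N) :
    ∃ X : Finset ℝ, (X.card : ℝ) ≤ 10 * N ∧ (∀ x ∈ X, |x| ≤ 5 / 4) ∧
      ∀ t ∈ Ico (-1 : ℝ) 1, ∃ x ∈ X, ∃ (j : ℕ) (y : ℝ),
        IsContact g (16 * M * 4 ^ j) x y ∧ |t - x| ≤ 1 / (N * 2 ^ j) := by
  classical
  set good : ℕ → ℤ → Prop := fun j i =>
    ∃ x y, IsContact g (16 * M * 4 ^ j) x y ∧ ⌊x * (N * 2 ^ j)⌋ = i with hgood
  have hpt : ∀ j i, ∃ x : ℝ, |x| ≤ 5 / 4 ∧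
      (good j i → ∃ y, IsContact g (16 * M * 4 ^ j) x y ∧ ⌊x * (N * 2 ^ j)⌋ = i) := by
    intro j i
    by_cases h : good j i
    · obtain ⟨x, y, hxy, hi⟩ := h
      exact ⟨x, hxy.1, fun _ => ⟨y, hxy, hi⟩⟩
    · exact ⟨0, by norm_num, fun h' => absurd h' h⟩
  choose pt hpt1 hpt2 using hpt
  set bad : ℕ → Finset ℤ := fun j =>
    (Finset.Ico (-(N * 2 ^ j : ℤ)) (N * 2 ^ j)).filter fun i => ¬ good j i with hbad
  have hbadcard : ∀ j, ((bad j).card : ℝ) ≤ N * (1 / 2) ^ j + 2 := fun j =>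
    card_cells_without_contact_le hg hc hM0 h0 hM N hN j (Finset.filter_subset _ _)
      fun i hi x y hxy hfl => (Finset.mem_filter.mp hi).2 ⟨x, y, hxy, hfl⟩
  set X₀ := (Finset.Ico (-(N : ℤ)) N).image (pt 0) with hX₀
  set X₁ := (Finset.range N).biUnion fun j =>
    (bad j).image (fun i => pt (j + 1) (2 * i)) ∪
      (bad j).image (fun i => pt (j + 1) (2 * i + 1)) with hX₁
  refine ⟨X₀ ∪ X₁, ?_, ?_, ?_⟩
  · have h1 : (X₀.card : ℝ) ≤ 2 * N := by
      have h := Finset.card_image_le (s := Finset.Ico (-(N : ℤ)) N) (f := pt 0)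
      rw [Int.card_Ico, ← hX₀] at h
      have h' : X₀.card ≤ 2 * N := by omega
      exact_mod_cast h'
    have h2 : (X₁.card : ℝ) ≤ ∑ j ∈ Finset.range N, 2 * (N * (1 / 2) ^ j + 2 : ℝ) := by
      have h : X₁.card ≤ ∑ j ∈ Finset.range N, 2 * (bad j).card := by
        refine Finset.card_biUnion_le.trans (Finset.sum_le_sum fun j _ => ?_)
        refine (Finset.card_union_le _ _).trans ?_
        have ha := Finset.card_image_le (s := bad j) (f := fun i => pt (j + 1) (2 * i))
        have hb := Finset.card_image_le (s := bad j) (f := fun i => pt (j + 1) (2 * i + 1))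
        omega
      calc (X₁.card : ℝ) ≤ ∑ j ∈ Finset.range N, 2 * ((bad j).card : ℝ) := by exact_mod_cast h
        _ ≤ _ := Finset.sum_le_sum fun j _ => by gcongr; exact hbadcard j
    have h3 : ∑ j ∈ Finset.range N, 2 * (N * (1 / 2) ^ j + 2 : ℝ) ≤ 8 * N := by
      rw [← Finset.mul_sum, Finset.sum_add_distrib, ← Finset.mul_sum, Finset.sum_const,
        Finset.card_range, nsmul_eq_mul]
      have := sum_geometric_two_le N
      nlinarith [(Nat.cast_nonneg N : (0 : ℝ) ≤ N)]
    have h4 : ((X₀ ∪ X₁).card : ℝ) ≤ X₀.card + X₁.card := by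
      exact_mod_cast Finset.card_union_le _ _
    linarith
  · intro x hx
    simp only [hX₀, hX₁, Finset.mem_union, Finset.mem_image, Finset.mem_biUnion] at hx
    rcases hx with ⟨i, -, rfl⟩ | ⟨j, -, ⟨i, -, rfl⟩ | ⟨i, -, rfl⟩⟩ <;> exact hpt1 _ _
  · intro t ht
    have hN0 : (0 : ℝ) < N := by exact_mod_cast hN
    have hmem : ∀ j : ℕ, ⌊t * (N * 2 ^ j)⌋ ∈ Finset.Ico (-(N * 2 ^ j : ℤ)) (N * 2 ^ j) := by
      intro j
      have hH : (0 : ℝ) < N * 2 ^ j := by positivity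
      rw [Finset.mem_Ico, Int.le_floor, Int.floor_lt]
      push_cast
      constructor <;> nlinarith [ht.1, ht.2]
    have hgoodN : good N ⌊t * (N * 2 ^ N)⌋ :=
      exists_isContact_floor_eq hg hc hM0 h0 hM N hN (hmem N)
    have hex : ∃ j, good j ⌊t * (N * 2 ^ j)⌋ := ⟨N, hgoodN⟩
    have hjN : Nat.find hex ≤ N := Nat.find_min' hex hgoodN
    have hjgood := Nat.find_spec hex
    have hjmin := fun i => Nat.find_min hex (m := i)
    generalize Nat.find hex = j at hjN hjgood hjmin
    obtain ⟨y, hy, hfl⟩ := hpt2 _ _ hjgood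
    refine ⟨pt j ⌊t * (N * 2 ^ j)⌋, ?_, j, y, hy, ?_⟩
    · rw [Finset.mem_union]
      rcases j with _ | j
      · left
        refine Finset.mem_image_of_mem _ ?_
        simpa using hmem 0
      · right
        have hb : ⌊t * (N * 2 ^ j)⌋ ∈ bad j :=
          Finset.mem_filter.mpr ⟨hmem j, hjmin j (Nat.lt_succ_self j)⟩
        refine Finset.mem_biUnion.mpr ⟨j, Finset.mem_range.mpr hjN, ?_⟩
        rw [Finset.mem_union, Finset.mem_image, Finset.mem_image]
        have h1 : t * (N * 2 ^ (j + 1)) = 2 * (t * (N * 2 ^ j)) := by ring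
        have h2 := Int.floor_le (t * (N * 2 ^ j))
        have h3 := Int.lt_floor_add_one (t * (N * 2 ^ j))
        have h4 : 2 * ⌊t * (N * 2 ^ j)⌋ ≤ ⌊t * (N * 2 ^ (j + 1))⌋ := by
          rw [Int.le_floor, h1]; push_cast; linarith
        have h5 : ⌊t * (N * 2 ^ (j + 1))⌋ < 2 * ⌊t * (N * 2 ^ j)⌋ + 2 := by
          rw [Int.floor_lt, h1]; push_cast; linarith
        rcases (by omega : ⌊t * (N * 2 ^ (j + 1))⌋ = 2 * ⌊t * (N * 2 ^ j)⌋ ∨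
          ⌊t * (N * 2 ^ (j + 1))⌋ = 2 * ⌊t * (N * 2 ^ j)⌋ + 1) with h | h
        · exact Or.inl ⟨_, hb, by rw [h]⟩
        · exact Or.inr ⟨_, hb, by rw [h]⟩
    · have hH : (0 : ℝ) < N * 2 ^ j := by positivity
      have h := (Int.abs_sub_lt_one_of_floor_eq_floor hfl.symm).le
      rw [← sub_mul, abs_mul, abs_of_pos hH] at h
      rwa [le_div_iff₀ hH]

/-- Angular equidistribution on `[-1, 1]`. -/
lemma exists_abs_arccos_sub_le {L : ℕ} (hL : 0 < L) {u : ℝ} :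
    ∃ j ∈ Finset.range (L + 1), |Real.arccos u - Real.arccos (Real.cos (j * Real.pi / L))| ≤
      Real.pi / L := by
  have hpi := Real.pi_pos
  have hL0 : (0 : ℝ) < L := by exact_mod_cast hL
  set j := ⌊Real.arccos u * L / Real.pi⌋₊ with hj
  have h0 : 0 ≤ Real.arccos u * L / Real.pi := by
    have := Real.arccos_nonneg u
    positivity
  have h1 := Nat.floor_le h0
  have h2 := Nat.lt_floor_add_one (Real.arccos u * L / Real.pi)
  rw [← hj] at h1 h2
  rw [le_div_iff₀ hpi] at h1
  rw [div_lt_iff₀ hpi] at h2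
  have hjL : (j : ℝ) ≤ L := by
    have := Real.arccos_le_pi u
    nlinarith
  refine ⟨j, Finset.mem_range.mpr (Nat.lt_succ_of_le (by exact_mod_cast hjL)), ?_⟩
  rw [Real.arccos_cos (by positivity) (by rw [div_le_iff₀ hL0]; nlinarith)]
  have h3 : Real.arccos u - j * Real.pi / L = (Real.arccos u * L - j * Real.pi) / L := by
    field_simp
  rw [h3, abs_div, abs_of_pos hL0, abs_of_nonneg (by linarith)]
  gcongr
  linarith

/-- The region under a positive concave graph carries meshes of quadratic size. -/
lemma exists_subgraph_mesh {g : ℝ → ℝ} (hg : ConcaveOn ℝ (Icc (-2) 2) g)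
    (hc : ContinuousOn g (Icc (-2) 2)) {b M : ℝ} (hb : 0 < b)
    (hgb : ∀ t ∈ Icc (-2 : ℝ) 2, b ≤ g t) (hM : ∀ t ∈ Icc (-2 : ℝ) 2, g t ≤ M) :
    ∃ C : ℝ, 0 < C ∧ ∀ k : ℝ, 1 ≤ k → ∃ Y : Finset (ℝ × ℝ), (Y.card : ℝ) ≤ C * k ^ 2 ∧
      (∀ z ∈ Y, z.1 ∈ Icc (-2 : ℝ) 2 ∧ 0 ≤ z.2 ∧ z.2 ≤ g z.1) ∧
      ∀ f, AngularLipschitz k g f → ∀ x ∈ Ico (-1 : ℝ) 1, ∀ y, 0 ≤ y → y ≤ g x →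
        ∃ z ∈ Y, |f x y - f z.1 z.2| ≤ 1 / 2 := by
  classical
  have h0 : ∀ t ∈ Icc (-2 : ℝ) 2, 0 ≤ g t := fun t ht => hb.le.trans (hgb t ht)
  have hbM : b ≤ M := (hgb 0 (by norm_num)).trans (hM 0 (by norm_num))
  have hM0 : 0 < M := hb.trans_le hbM
  refine ⟨180 * (192 * M / b + 1), by positivity, fun k hk => ?_⟩
  have hk0 : 0 < k := by linarith
  set N := ⌈192 * M * k / b⌉₊ with hN
  have hNpos : 0 < 192 * M * k / b := by positivity
  have hN1 : 1 ≤ N := Nat.one_le_ceil_iff.mpr hNpos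
  have hNle : 192 * M * k / b ≤ N := Nat.le_ceil _
  have hNlt : (N : ℝ) < 192 * M * k / b + 1 := Nat.ceil_lt_add_one hNpos.le
  have hN0 : (0 : ℝ) < N := by exact_mod_cast hN1
  set L := ⌈16 * k⌉₊ with hL
  have hL1 : 0 < L := Nat.ceil_pos.mpr (by positivity)
  have hLle : 16 * k ≤ L := Nat.le_ceil _
  have hLlt : (L : ℝ) < 16 * k + 1 := Nat.ceil_lt_add_one (by positivity)
  have hL0 : (0 : ℝ) < L := by exact_mod_cast hL1
  obtain ⟨X, hXcard, hX, hXcov⟩ := exists_finset_isContact hg hc hM0 h0 hM N hN1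
  set s : ℕ → ℝ := fun j => (1 + Real.cos (j * Real.pi / L)) / 2 with hs
  have hs01 : ∀ j, s j ∈ Icc (0 : ℝ) 1 := fun j => by
    have h1 := Real.neg_one_le_cos (j * Real.pi / L)
    have h2 := Real.cos_le_one (j * Real.pi / L)
    constructor <;> simp only [hs] <;> linarith
  have hX2 : ∀ x ∈ X, x ∈ Icc (-2 : ℝ) 2 := fun x hx => by
    have := abs_le.mp (hX x hx)
    exact ⟨by linarith, by linarith⟩
  refine ⟨(X ×ˢ Finset.range (L + 1)).image fun z => (z.1, s z.2 * g z.1), ?_, ?_, ?_⟩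
  · have h1 : (((X ×ˢ Finset.range (L + 1)).image fun z => (z.1, s z.2 * g z.1)).card : ℝ) ≤
        X.card * (L + 1) := by
      have := Finset.card_image_le (s := X ×ˢ Finset.range (L + 1))
        (f := fun z => (z.1, s z.2 * g z.1))
      rw [Finset.card_product, Finset.card_range] at this
      exact_mod_cast this
    have h2 : (N : ℝ) ≤ (192 * M / b + 1) * k := by
      have : 192 * M * k / b = 192 * M / b * k := by ring
      rw [this] at hNlt
      linarith
    calc _ ≤ _ := h1
      _ ≤ (10 * ((192 * M / b + 1) * k)) * (18 * k) := by
        gcongr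
        · exact hXcard.trans (by gcongr)
        · linarith
      _ = _ := by ring
  · intro z hz
    obtain ⟨⟨x, j⟩, hxj, rfl⟩ := Finset.mem_image.mp hz
    have hx := hX2 x (Finset.mem_product.mp hxj).1
    exact ⟨hx, mul_nonneg (hs01 j).1 (h0 x hx), mul_le_of_le_one_left (h0 x hx) (hs01 j).2⟩
  · intro f hf x hx y hy0 hyg
    have hx2 : x ∈ Icc (-2 : ℝ) 2 := ⟨by linarith [hx.1], by linarith [hx.2]⟩
    have hgx : 0 < g x := hb.trans_le (hgb x hx2)
    set u := 2 * y / g x - 1 with hu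
    have hu1 : u ∈ Icc (-1 : ℝ) 1 := by
      have h1 : 0 ≤ 2 * y / g x := by positivity
      have h2 : 2 * y / g x ≤ 2 := by rw [div_le_iff₀ hgx]; linarith
      exact ⟨by linarith, by linarith⟩
    have huy : (1 + u) / 2 * g x = y := by rw [hu]; field_simp; ring
    obtain ⟨j, hj, hjle⟩ := exists_abs_arccos_sub_le hL1 (u := u)
    have hstep1 := hf.vertical h0 hx2 hu1 (Real.cos_mem_Icc (j * Real.pi / L))
    rw [huy] at hstep1
    have hstep1' : |f x y - f x (s j * g x)| ≤ 1 / 4 := by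
      refine hstep1.trans ?_
      calc k * _ ≤ k * (Real.pi / L) := by gcongr
        _ ≤ k * (4 / (16 * k)) := by gcongr; exact Real.pi_le_four
        _ = 1 / 4 := by field_simp; norm_num
    obtain ⟨x', hx', i, v, hcon, hxx'⟩ := hXcov x hx
    have hpow : (1 : ℝ) ≤ 2 ^ i := one_le_pow₀ (by norm_num)
    have ha : b / (8 * M * 2 ^ i) ≤ b / (8 * M) :=
      div_le_div_of_nonneg_left hb.le (by positivity)
        (le_mul_of_one_le_right (by positivity) hpow)
    have ha' : b / (8 * M) ≤ 1 / 8 := by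
      rw [div_le_div_iff₀ (by positivity) (by norm_num)]; linarith
    have hstep2 := (hf.scale (hs01 j)).abs_sub_le_of_isContact hk0 hb hgb hM hcon (by positivity)
      (a := b / (8 * M * 2 ^ i)) (t := x) (by positivity) (by linarith)
      (by
        have h1 : 2 * (16 * M * 4 ^ i) * (b / (8 * M * 2 ^ i)) ^ 2 = b * (b / (8 * M) * 4) := by
          rw [show (4 : ℝ) ^ i = 2 ^ i * 2 ^ i by rw [← mul_pow]; norm_num]
          field_simp; norm_num
        rw [h1]
        exact mul_le_of_le_one_right hb.le (by linarith))
      (by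
        calc 2 * M * (b / (8 * M * 2 ^ i)) ≤ 2 * M * (b / (8 * M)) := by gcongr
          _ = b / 4 := by field_simp; norm_num
          _ ≤ b / 2 := by linarith)
      (hxx'.trans (by
        rw [div_le_iff₀ hb] at hNle
        rw [div_div, div_le_div_iff₀ (by positivity) (by positivity)]
        have : 0 < (2 : ℝ) ^ i := by positivity
        nlinarith)) hk
    refine ⟨(x', s j * g x'), Finset.mem_image.mpr
      ⟨(x', j), Finset.mem_product.mpr ⟨hx', hj⟩, rfl⟩, ?_⟩
    calc _ ≤ |f x y - f x (s j * g x)| + |f x (s j * g x) - f x' (s j * g x')| := abs_sub_le _ _ _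
      _ ≤ 1 / 4 + 1 / 4 := add_le_add hstep1' hstep2
      _ = 1 / 2 := by norm_num

/-! ### Polynomial meshes of subsets of a planar body -/

/-- A polynomial of degree at most `n` bounded by `K` on `D` is, along a parabolic arc in `D`,
Lipschitz in the angular parameter. -/
theorem abs_eval_div_sub_le_arccos {D : Set E2} {p : MvPolynomial (Fin 2) ℝ} {n : ℕ}
    (hn : 1 ≤ n) (hp : p.totalDegree ≤ n) {K : ℝ} (hK : 0 < K)
    (hpK : ∀ z ∈ D, |MvPolynomial.eval (fun i => z i) p| ≤ K) (P Q R : E2)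
    (hD : ∀ u ∈ Icc (-1 : ℝ) 1, P + u • Q + u ^ 2 • R ∈ D)
    {u v : ℝ} (hu : u ∈ Icc (-1 : ℝ) 1) (hv : v ∈ Icc (-1 : ℝ) 1) :
    |MvPolynomial.eval (fun i => (P + u • Q + u ^ 2 • R) i) p / K -
      MvPolynomial.eval (fun i => (P + v • Q + v ^ 2 • R) i) p / K| ≤
      (6 * n : ℕ) * |Real.arccos u - Real.arccos v| := by
  set F : Fin 2 → Polynomial ℝ := fun i =>
    Polynomial.C (P i) + Polynomial.C (Q i) * Polynomial.X
      + Polynomial.C (R i) * Polynomial.X ^ 2 with hF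
  set q : Polynomial ℝ := MvPolynomial.aeval F p * Polynomial.C K⁻¹ with hq
  have hFd : ∀ i, (F i).natDegree ≤ 2 := fun i => by
    simp only [hF]
    compute_degree
  have hqd : q.natDegree ≤ n * 2 :=
    (Polynomial.natDegree_mul_C_le _ _).trans (MvPolynomial.aeval_natDegree_le p hp F hFd)
  have hqe : ∀ t : ℝ, q.eval t =
      MvPolynomial.eval (fun i => (P + t • Q + t ^ 2 • R) i) p / K := fun t => by
    have h := MvPolynomial.comp_aeval_apply F (Polynomial.aeval t) p
    rw [Polynomial.coe_aeval_eq_eval] at h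
    have hFt : (fun i => (F i).eval t) = fun i => (P + t • Q + t ^ 2 • R) i := by
      ext i
      simp only [hF, Polynomial.eval_add, Polynomial.eval_mul, Polynomial.eval_C,
        Polynomial.eval_X, Polynomial.eval_pow, PiLp.add_apply, PiLp.smul_apply, smul_eq_mul]
      ring
    rw [hq, Polynomial.eval_mul, Polynomial.eval_C, h, div_eq_mul_inv, hFt,
      MvPolynomial.aeval_eq_eval]
  have hb : ∀ t ∈ Icc (-1 : ℝ) 1, |q.eval t| ≤ 1 := fun t ht => by
    rw [hqe, abs_div, abs_of_pos hK, div_le_one hK]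
    exact hpK _ (hD t ht)
  have h := abs_eval_sub_eval_le_arccos hqd (by omega) hb hu hv
  rw [hqe, hqe] at h
  refine h.trans_eq ?_
  push_cast
  ring

/-- `S` is resolved, up to half the norm on `D`, by `O(n ^ 2)` points of `D`, uniformly over
polynomials of degree at most `n`. -/
def HasMesh (D S : Set E2) : Prop :=
  ∃ C : ℝ, 0 < C ∧ ∀ n : ℕ, 1 ≤ n → ∃ Y : Finset E2, ↑Y ⊆ D ∧ (Y.card : ℝ) ≤ C * (n : ℝ) ^ 2 ∧
    ∀ p : MvPolynomial (Fin 2) ℝ, p.totalDegree ≤ n → ∀ K : ℝ, 0 < K →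
      (∀ z ∈ D, |MvPolynomial.eval (fun i => z i) p| ≤ K) → ∀ z ∈ S, ∃ y ∈ Y,
        |MvPolynomial.eval (fun i => z i) p - MvPolynomial.eval (fun i => y i) p| ≤ K / 2

theorem HasMesh.empty (D : Set E2) : HasMesh D ∅ :=
  ⟨1, one_pos, fun n _ => ⟨∅, by simp, by simp, by simp⟩⟩

theorem HasMesh.mono {D S T : Set E2} (hST : S ⊆ T) (h : HasMesh D T) : HasMesh D S := by
  obtain ⟨C, hC, h⟩ := h
  refine ⟨C, hC, fun n hn => ?_⟩
  obtain ⟨Y, hY, hcard, h⟩ := h n hn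
  exact ⟨Y, hY, hcard, fun p hp K hK hpK z hz => h p hp K hK hpK z (hST hz)⟩

theorem HasMesh.union {D S T : Set E2} (hS : HasMesh D S) (hT : HasMesh D T) :
    HasMesh D (S ∪ T) := by
  classical
  obtain ⟨A, hA, hS⟩ := hS
  obtain ⟨B, hB, hT⟩ := hT
  refine ⟨A + B, by positivity, fun n hn => ?_⟩
  obtain ⟨Y, hYD, hYc, hY⟩ := hS n hn
  obtain ⟨Z, hZD, hZc, hZ⟩ := hT n hn
  refine ⟨Y ∪ Z, ?_, ?_, ?_⟩
  · rw [Finset.coe_union]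
    exact union_subset hYD hZD
  · have h : ((Y ∪ Z).card : ℝ) ≤ Y.card + Z.card := by exact_mod_cast Finset.card_union_le Y Z
    linarith
  · rintro p hp K hK hpK z (hz | hz)
    · obtain ⟨y, hy, h⟩ := hY p hp K hK hpK z hz
      exact ⟨y, Finset.mem_union_left _ hy, h⟩
    · obtain ⟨y, hy, h⟩ := hZ p hp K hK hpK z hz
      exact ⟨y, Finset.mem_union_right _ hy, h⟩

/-- In affine coordinates in which `D` contains a rectangle over `[-3, 3]`, the part of `D` above
`[-1, 1)` has a mesh. -/
theorem hasMesh_of_chart {D : Set E2} (hconv : Convex ℝ D) (hcomp : IsCompact D) {c v w : E2}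
    (hw : w ≠ 0) {η : ℝ} (hη : 0 < η)
    (hin : ∀ x ∈ Icc (-3 : ℝ) 3, ∀ y ∈ Icc 0 η, c + x • v + y • w ∈ D) :
    HasMesh D {z | z ∈ D ∧ ∃ x ∈ Ico (-1 : ℝ) 1, ∃ y : ℝ, 0 ≤ y ∧ z = c + x • v + y • w} := by
  classical
  obtain ⟨B, hB⟩ := hcomp.isBounded.exists_norm_le
  have hw' : 0 < ‖w‖ := norm_pos_iff.2 hw
  set M : ℝ := (B + ‖c‖ + 3 * ‖v‖) / ‖w‖ with hM
  set g : ℝ → ℝ := fun x => sSup {y | c + x • v + y • w ∈ D} with hg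
  have hup : ∀ x ∈ Icc (-3 : ℝ) 3, ∀ y, c + x • v + y • w ∈ D → y ≤ M := fun x hx y hy => by
    rw [hM, le_div_iff₀ hw']
    have h₁ : ‖y • w‖ ≤ ‖c + x • v + y • w‖ + ‖c‖ + ‖x • v‖ := by
      calc ‖y • w‖ = ‖(c + x • v + y • w) - c - x • v‖ := by congr 1; abel
        _ ≤ ‖(c + x • v + y • w) - c‖ + ‖x • v‖ := norm_sub_le _ _
        _ ≤ _ := by gcongr; exact norm_sub_le _ _
    rw [norm_smul, norm_smul, Real.norm_eq_abs, Real.norm_eq_abs] at h₁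
    have h₂ : |x| * ‖v‖ ≤ 3 * ‖v‖ := by gcongr; exact abs_le.2 hx
    have h₃ : y * ‖w‖ ≤ |y| * ‖w‖ := by gcongr; exact le_abs_self y
    linarith [hB _ hy]
  have hbdd : ∀ x ∈ Icc (-3 : ℝ) 3, BddAbove {y | c + x • v + y • w ∈ D} :=
    fun x hx => ⟨M, fun y hy => hup x hx y hy⟩
  have hle : ∀ x ∈ Icc (-3 : ℝ) 3, ∀ y, c + x • v + y • w ∈ D → y ≤ g x :=
    fun x hx y hy => le_csSup (hbdd x hx) hy
  have hηg : ∀ x ∈ Icc (-3 : ℝ) 3, η ≤ g x :=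
    fun x hx => hle x hx η (hin x hx η ⟨hη.le, le_rfl⟩)
  have hgD : ∀ x ∈ Icc (-3 : ℝ) 3, c + x • v + g x • w ∈ D := fun x hx => by
    have hcl : IsClosed {y : ℝ | c + x • v + y • w ∈ D} :=
      hcomp.isClosed.preimage (by fun_prop)
    exact hcl.csSup_mem ⟨0, hin x hx 0 ⟨le_rfl, hη.le⟩⟩ (hbdd x hx)
  have hmem : ∀ x ∈ Icc (-3 : ℝ) 3, ∀ y, 0 ≤ y → y ≤ g x → c + x • v + y • w ∈ D := by
    intro x hx y hy hyg
    have hpos : 0 < g x := hη.trans_le (hηg x hx)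
    have h := hconv (hin x hx 0 ⟨le_rfl, hη.le⟩) (hgD x hx)
      (sub_nonneg.2 ((div_le_one hpos).2 hyg)) (div_nonneg hy hpos.le) (by ring)
    convert h using 1
    have : y = y / g x * g x := by field_simp
    nth_rewrite 1 [this]
    module
  have hconc : ConcaveOn ℝ (Icc (-3 : ℝ) 3) g := by
    refine ⟨convex_Icc _ _, fun x hx y hy a b ha hb hab => ?_⟩
    refine hle _ (convex_Icc _ _ hx hy ha hb hab) _ ?_
    convert hconv (hgD x hx) (hgD y hy) ha hb hab using 1
    obtain rfl : b = 1 - a := by linarith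
    simp only [smul_eq_mul]
    module
  have h23 : Icc (-2 : ℝ) 2 ⊆ Icc (-3) 3 := Icc_subset_Icc (by norm_num) (by norm_num)
  have hcont : ContinuousOn g (Icc (-2 : ℝ) 2) := by
    refine hconc.continuousOn_interior.mono ?_
    rw [interior_Icc]
    exact Icc_subset_Ioo (by norm_num) (by norm_num)
  obtain ⟨C, hC, hmesh⟩ := exists_subgraph_mesh (hconc.subset h23 (convex_Icc _ _)) hcont hη
    (fun t ht => hηg t (h23 ht)) (fun t ht => hup t (h23 ht) _ (hgD t (h23 ht)))
  refine ⟨C * 36, by positivity, fun n hn => ?_⟩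
  obtain ⟨Y, hYc, hYg, hY⟩ := hmesh (6 * n : ℕ) (by norm_cast; omega)
  refine ⟨Y.image fun z => c + z.1 • v + z.2 • w, ?_, ?_, ?_⟩
  · intro z hz
    obtain ⟨y, hy, rfl⟩ := Finset.mem_image.1 (Finset.mem_coe.1 hz)
    obtain ⟨h₁, h₂, h₃⟩ := hYg y hy
    exact hmem _ (h23 h₁) _ h₂ h₃
  · have h : ((Y.image fun z => c + z.1 • v + z.2 • w).card : ℝ) ≤ Y.card := by
      exact_mod_cast Finset.card_image_le
    refine h.trans (hYc.trans_eq ?_)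
    push_cast
    ring
  · rintro p hp K hK hpK z ⟨hzD, x, hx, y, hy, rfl⟩
    have hx3 : x ∈ Icc (-3 : ℝ) 3 := ⟨by linarith [hx.1], by linarith [hx.2]⟩
    have hlip : AngularLipschitz (6 * n : ℕ) g
        (fun x y => MvPolynomial.eval (fun i => (c + x • v + y • w) i) p / K) := by
      intro a₀ a₁ b₀ b₁ b₂ hab s hs t ht
      have hcurve : ∀ u : ℝ, c + (a₀ + a₁ * u) • v + (b₀ + b₁ * u + b₂ * u ^ 2) • w =
          (c + a₀ • v + b₀ • w) + u • (a₁ • v + b₁ • w) + u ^ 2 • (b₂ • w) := fun u => by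
        module
      simp only [hcurve]
      refine abs_eval_div_sub_le_arccos hn hp hK hpK _ _ _ (fun u hu => ?_) hs ht
      rw [← hcurve]
      obtain ⟨h₁, h₂, h₃⟩ := hab u hu
      exact hmem _ (h23 h₁) _ h₂ h₃
    obtain ⟨z, hz, h⟩ := hY _ hlip x hx y hy (hle x hx3 y hzD)
    refine ⟨_, Finset.mem_image_of_mem _ hz, ?_⟩
    rw [← sub_div, abs_div, abs_of_pos hK, div_le_iff₀ hK] at h
    linarith

theorem exists_mem_nhdsWithin_hasMesh {D : Set E2} (hD : IsConvexBody D) (z₀ : E2) :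
    ∃ t ∈ nhdsWithin z₀ D, HasMesh D t := by
  obtain ⟨hconv, hcomp, hinter⟩ := hD
  obtain ⟨c, hcD, hcz⟩ := (dense_compl_singleton z₀).inter_open_nonempty _ isOpen_interior hinter
  obtain ⟨r, hr, hball⟩ := Metric.isOpen_iff.1 isOpen_interior c hcD
  set w : E2 := z₀ - c with hwdef
  have hw : w ≠ 0 := sub_ne_zero.2 (Ne.symm hcz)
  set e : E2 := !₂[-w 1, w 0] with he
  have hw' : 0 < ‖w‖ := norm_pos_iff.2 hw
  have hN : 0 < w 0 ^ 2 + w 1 ^ 2 := by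
    have h := EuclideanSpace.norm_sq_eq w
    simp only [Fin.sum_univ_two, Real.norm_eq_abs, sq_abs] at h
    rw [← h]
    positivity
  set L : ℝ := ‖w‖ + ‖e‖ with hL
  have hLpos : 0 < L := by positivity
  set η : ℝ := r / (8 * L) with hηdef
  have hη : 0 < η := by positivity
  have hηL : η * L = r / 8 := by rw [hηdef]; field_simp
  have hin : ∀ x ∈ Icc (-3 : ℝ) 3, ∀ y ∈ Icc 0 η, c + x • (η • e) + y • w ∈ D := by
    intro x hx y hy
    refine interior_subset (hball ?_)
    rw [Metric.mem_ball, dist_eq_norm]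
    have h₁ : ‖c + x • (η • e) + y • w - c‖ ≤ |x| * (η * ‖e‖) + y * ‖w‖ := by
      calc ‖c + x • (η • e) + y • w - c‖ = ‖x • (η • e) + y • w‖ := by congr 1; abel
        _ ≤ ‖x • (η • e)‖ + ‖y • w‖ := norm_add_le _ _
        _ = _ := by
          rw [norm_smul, norm_smul, norm_smul, Real.norm_eq_abs, Real.norm_eq_abs,
            Real.norm_eq_abs, abs_of_pos hη, abs_of_nonneg hy.1]
    have h₂ : |x| * (η * ‖e‖) ≤ 3 * (η * ‖e‖) := by gcongr; exact abs_le.2 hx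
    have h₃ : y * ‖w‖ ≤ η * ‖w‖ := by gcongr; exact hy.2
    have h₄ : 0 ≤ η * ‖w‖ := by positivity
    have h₅ : η * ‖w‖ + η * ‖e‖ = r / 8 := by rw [← hηL, hL]; ring
    linarith
  set X : E2 → ℝ := fun z =>
    ((z 1 - c 1) * w 0 - (z 0 - c 0) * w 1) / (η * (w 0 ^ 2 + w 1 ^ 2)) with hX
  set Y : E2 → ℝ := fun z =>
    ((z 0 - c 0) * w 0 + (z 1 - c 1) * w 1) / (w 0 ^ 2 + w 1 ^ 2) with hY
  have hXc : Continuous X := by fun_prop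
  have hYc : Continuous Y := by fun_prop
  have hXY : ∀ z, z = c + X z • (η • e) + Y z • w := fun z => by
    ext i
    fin_cases i <;> simp [hX, hY, he] <;> field_simp <;> ring
  have hz0 : z₀ 0 - c 0 = w 0 := rfl
  have hz1 : z₀ 1 - c 1 = w 1 := rfl
  have hX0 : X z₀ = 0 := by simp only [hX, hz0, hz1]; ring
  have hY0 : Y z₀ = 1 := by simp only [hY, hz0, hz1]; field_simp
  refine ⟨_, ?_, hasMesh_of_chart hconv hcomp hw hη hin⟩
  have hX' : ∀ᶠ z in nhdsWithin z₀ D, X z ∈ Ioo (-1 : ℝ) 1 :=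
    hXc.continuousWithinAt.eventually_mem (Ioo_mem_nhds (by rw [hX0]; norm_num)
      (by rw [hX0]; norm_num))
  have hY' : ∀ᶠ z in nhdsWithin z₀ D, Y z ∈ Ioi (0 : ℝ) :=
    hYc.continuousWithinAt.eventually_mem (Ioi_mem_nhds (by rw [hY0]; norm_num))
  filter_upwards [hX', hY', self_mem_nhdsWithin] with z hzX hzY hzD
  exact ⟨hzD, X z, Ioo_subset_Ico_self hzX, Y z, le_of_lt hzY, hXY z⟩

theorem IsConvexBody.hasMesh {D : Set E2} (hD : IsConvexBody D) : HasMesh D D :=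
  hD.2.1.induction_on (p := HasMesh D) (HasMesh.empty D) (fun _ _ h => HasMesh.mono h)
    (fun _ _ => HasMesh.union) fun z _ => exists_mem_nhdsWithin_hasMesh hD z

/-- `ε`-version of existence of optimal polynomial meshes in planar convex bodies. -/
theorem stmt9 (D : Set E2) (hD : IsConvexBody D) (ε : ℝ) (hε : 0 < ε) :
    ∃ μ : ℝ, 0 < μ ∧ ∀ n : ℕ, 1 ≤ n → ∃ Y : Finset E2,
      ↑Y ⊆ D ∧ (Y.card : ℝ) ≤ μ * (n : ℝ) ^ 2 ∧
      ∀ p : MvPolynomial (Fin 2) ℝ, p.totalDegree ≤ n → ∀ z ∈ D,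
        |MvPolynomial.eval (fun i => z i) p| ≤
          (1 + ε) * sSup ((fun y : E2 => |MvPolynomial.eval (fun i => y i) p|) '' ↑Y) := by
  obtain ⟨C, hC, hmesh⟩ := hD.hasMesh
  obtain ⟨k, hk⟩ := pow_unbounded_of_one_lt 2 (by linarith : (1 : ℝ) < 1 + ε)
  have hk0 : k ≠ 0 := by
    rintro rfl
    norm_num at hk
  refine ⟨C * (k : ℝ) ^ 2, by positivity, fun n hn => ?_⟩
  obtain ⟨Y, hYD, hYc, hY⟩ := hmesh (k * n) (Nat.mul_pos (Nat.pos_of_ne_zero hk0) hn)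
  refine ⟨Y, hYD, hYc.trans_eq (by push_cast; ring), fun p hp z hz => ?_⟩
  set P : E2 → ℝ := fun y => MvPolynomial.eval (fun i => y i) p with hP
  have hPc : Continuous fun y => |P y| := by
    have h : Continuous P := p.continuous_eval.comp (by fun_prop)
    exact h.abs
  obtain ⟨z₀, hz₀, hmax⟩ := hD.2.1.exists_isMaxOn ⟨z, hz⟩ hPc.continuousOn
  have hsup : 0 ≤ sSup ((fun y : E2 => |P y|) '' ↑Y) := by
    apply Real.sSup_nonneg
    rintro _ ⟨y, -, rfl⟩
    exact abs_nonneg _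
  have hzz : |P z| ≤ |P z₀| := hmax hz
  refine hzz.trans ?_
  rcases (abs_nonneg (P z₀)).eq_or_lt with h0 | h0
  · rw [← h0]
    positivity
  have hpow : ∀ y : E2, MvPolynomial.eval (fun i => y i) (p ^ k) = P y ^ k := fun y => by
    rw [map_pow]
  obtain ⟨y, hy, h⟩ := hY (p ^ k)
    ((MvPolynomial.totalDegree_pow p k).trans (Nat.mul_le_mul_left k hp)) (|P z₀| ^ k)
    (by positivity)
    (fun y hy => by
      rw [hpow, abs_pow]
      exact pow_le_pow_left₀ (abs_nonneg _) (hmax hy) k) z₀ hz₀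
  rw [hpow, hpow] at h
  have h₁ : |P z₀| ^ k - |P y| ^ k ≤ |P z₀| ^ k / 2 := by
    have h' := (abs_sub_abs_le_abs_sub _ _).trans h
    rwa [abs_pow, abs_pow] at h'
  have h₂ : |P z₀| ^ k ≤ ((1 + ε) * |P y|) ^ k := by
    rw [mul_pow]
    have : 2 * |P y| ^ k ≤ (1 + ε) ^ k * |P y| ^ k := by gcongr
    linarith
  have h₃ : |P z₀| ≤ (1 + ε) * |P y| := (pow_le_pow_iff_left₀ h0.le (by positivity) hk0).1 h₂
  refine h₃.trans ?_
  gcongr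
  exact le_csSup (Y.finite_toSet.image _).bddAbove ⟨y, hy, rfl⟩
end
end
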